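/- arXiv:1305.6356 — 3 statements merged into one kernel-verified Lean document; each statement's English description precedes it below -/
import Mathlib

section
/- Let p be an odd prime and let ε ∈ {−1, 0, 1}. Then, as x → ∞, the proportion #{D : 1 < D ≤ x, D a fundamental discriminant, (D|p) = ε} / #{D : 1 < D ≤ x, D a fundamental discriminant} converges to p/(2p+2) if ε = 1, to p/(2p+2) if ε = −1, and to 1/(p+1) if ε = 0. -/
open Filter

/-- An integer `D ≠ 1` is a fundamental discriminant if either `D ≡ 1 (mod 4)` and `D` is
squarefree, or `4 ∣ D`, `D/4` is squarefree and `D/4 ≡ 2` or `3 (mod 4)`. -/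
def IsFundamentalDiscriminant (D : ℤ) : Prop :=
  D ≠ 1 ∧ ((D % 4 = 1 ∧ Squarefree D) ∨
    (4 ∣ D ∧ Squarefree (D / 4) ∧ (D / 4 % 4 = 2 ∨ D / 4 % 4 = 3)))

/-- Partial sums of a periodic function with mean zero are bounded. -/
theorem exists_abs_sum_range_le_of_periodic {v : ℕ → ℝ} {T : ℕ} (hT : 0 < T)
    (hv : Function.Periodic v T) (h0 : ∑ n ∈ Finset.range T, v n = 0) :
    ∃ C : ℝ, ∀ N : ℕ, |∑ n ∈ Finset.range N, v n| ≤ C := by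
  have hper : Function.Periodic (fun N => ∑ n ∈ Finset.range N, v n) T := by
    intro N
    simp only
    rw [add_comm N T, Finset.sum_range_add, h0, zero_add]
    refine Finset.sum_congr rfl fun n _ => ?_
    rw [add_comm, hv]
  refine ⟨∑ n ∈ Finset.range T, |v n|, fun N => ?_⟩
  rw [← hper.map_mod_nat N]
  refine (Finset.abs_sum_le_sum_abs _ _).trans ?_
  exact Finset.sum_le_sum_of_subset_of_nonneg
    (Finset.range_mono (Nat.mod_lt N hT).le) fun _ _ _ => abs_nonneg _

theorem sum_range_mul_of_periodic {f g : ℕ → ℝ} {a b : ℕ} (ha : 0 < a) (hb : 0 < b)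
    (hab : a.Coprime b) (hf : Function.Periodic f a) (hg : Function.Periodic g b) :
    ∑ n ∈ Finset.range (a * b), f n * g n =
      (∑ n ∈ Finset.range a, f n) * ∑ n ∈ Finset.range b, g n := by
  rw [Finset.sum_mul_sum, ← Finset.sum_product']
  refine Finset.sum_nbij (fun n => (n % a, n % b)) ?_ ?_ ?_ ?_
  · intro n _
    simp [Nat.mod_lt _ ha, Nat.mod_lt _ hb]
  · intro m hm n hn h
    simp only [Finset.coe_range, Set.mem_Iio, Prod.mk.injEq] at hm hn h
    exact Nat.ModEq.eq_of_lt_of_lt ((Nat.modEq_and_modEq_iff_modEq_mul hab).1 h) hm hn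
  · rintro ⟨i, j⟩ hij
    simp only [Finset.coe_product, Finset.coe_range, Set.mem_prod, Set.mem_Iio] at hij
    refine ⟨Nat.chineseRemainder hab i j, ?_, ?_⟩
    · simpa using Nat.chineseRemainder_lt_mul hab i j ha.ne' hb.ne'
    · have h := (Nat.chineseRemainder hab i j).2
      exact Prod.ext (Eq.trans h.1 (Nat.mod_eq_of_lt hij.1)) (Eq.trans h.2 (Nat.mod_eq_of_lt hij.2))
  · intro n _
    simp only
    rw [hf.map_mod_nat, hg.map_mod_nat]

theorem sum_range_mul_left_of_periodic {f : ℕ → ℝ} {a : ℕ} (hf : Function.Periodic f a) (b : ℕ) :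
    ∑ n ∈ Finset.range (b * a), f n = b * ∑ n ∈ Finset.range a, f n := by
  induction b with
  | zero => simp
  | succ b ih =>
    rw [add_mul, one_mul, Finset.sum_range_add, ih, Nat.cast_succ, add_mul, one_mul]
    congr 1
    refine Finset.sum_congr rfl fun n _ => ?_
    rw [add_comm]
    exact hf.nat_mul b n

theorem sum_range_natCast_zmod (p : ℕ) [NeZero p] (f : ZMod p → ℝ) :
    ∑ n ∈ Finset.range p, f n = ∑ a, f a := by
  refine Finset.sum_nbij (fun n => (n : ZMod p)) (by simp) ?_ ?_ (by simp)
  · intro m hm n hn h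
    simp only [Finset.coe_range, Set.mem_Iio] at hm hn
    exact Nat.ModEq.eq_of_lt_of_lt ((ZMod.natCast_eq_natCast_iff _ _ _).1 h) hm hn
  · intro a _
    exact ⟨a.val, by simpa using ZMod.val_lt a, by simp⟩

/-- The claimed density of fundamental discriminants with `(D|p) = ε`. -/
noncomputable def legendreDensity (p : ℕ) (ε : ℤ) : ℝ :=
  if ε = 0 then 1 / ((p : ℝ) + 1) else (p : ℝ) / (2 * p + 2)

theorem legendreDensity_nonneg (p : ℕ) (ε : ℤ) : 0 ≤ legendreDensity p ε := by
  unfold legendreDensity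
  split_ifs <;> positivity

theorem legendreDensity_le_one (p : ℕ) (ε : ℤ) : legendreDensity p ε ≤ 1 := by
  unfold legendreDensity
  have : (0 : ℝ) ≤ p := p.cast_nonneg
  split_ifs
  · rw [div_le_one (by positivity)]; linarith
  · rw [div_le_one (by positivity)]; linarith

/-- The indicator of `(n|p) = ε`, centred at the claimed density. -/
noncomputable def legendreWeight (p : ℕ) [Fact p.Prime] (ε : ℤ) (n : ℕ) : ℝ :=
  (if legendreSym p n = ε then 1 else 0) - legendreDensity p ε

theorem abs_legendreWeight_le_one (p : ℕ) [Fact p.Prime] (ε : ℤ) (n : ℕ) :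
    |legendreWeight p ε n| ≤ 1 := by
  have h0 := legendreDensity_nonneg p ε
  have h1 := legendreDensity_le_one p ε
  unfold legendreWeight
  split_ifs <;> rw [abs_le] <;> constructor <;> linarith

theorem legendreWeight_periodic (p : ℕ) [Fact p.Prime] (ε : ℤ) :
    Function.Periodic (legendreWeight p ε) p := by
  intro n
  simp [legendreWeight, legendreSym]

theorem sum_range_legendreSym_eq (p : ℕ) [Fact p.Prime] (hodd : p ≠ 2) {ε : ℤ}
    (hε : ε = -1 ∨ ε = 0 ∨ ε = 1) :
    ∑ n ∈ Finset.range p, (if legendreSym p n = ε then (1 : ℝ) else 0) =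
      if ε = 0 then 1 else ((p : ℝ) - 1) / 2 := by
  have hs : ∑ a : ZMod p, (quadraticChar (ZMod p) a : ℝ) = 0 := by
    exact_mod_cast quadraticChar_sum_zero (F := ZMod p) (by rwa [ZMod.ringChar_zmod_n])
  have h0 : ∑ a : ZMod p, (if a = 0 then (1 : ℝ) else 0) = 1 := by simp
  have hp : ∑ a : ZMod p, (1 : ℝ) = p := by simp
  have key := sum_range_natCast_zmod p
    fun a => if quadraticChar (ZMod p) a = ε then (1 : ℝ) else 0
  simp only [legendreSym, Int.cast_natCast]
  rw [key]
  have hchar (a : ZMod p) : a = 0 ∧ quadraticChar (ZMod p) a = 0 ∨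
      a ≠ 0 ∧ (quadraticChar (ZMod p) a = 1 ∨ quadraticChar (ZMod p) a = -1) := by
    by_cases ha : a = 0
    · simp [ha]
    · exact Or.inr ⟨ha, quadraticChar_dichotomy ha⟩
  rcases hε with rfl | rfl | rfl
  · have (a : ZMod p) : (if quadraticChar (ZMod p) a = -1 then (1 : ℝ) else 0) =
        (1 - (if a = 0 then 1 else 0) - quadraticChar (ZMod p) a) / 2 := by
      rcases hchar a with ⟨h, h'⟩ | ⟨h, h' | h'⟩ <;> rw [h'] <;> norm_num [h]
    simp_rw [this]
    rw [← Finset.sum_div, Finset.sum_sub_distrib, Finset.sum_sub_distrib, hs, h0, hp]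
    norm_num
  · simp only [quadraticChar_eq_zero_iff, h0, if_true]
  · have (a : ZMod p) : (if quadraticChar (ZMod p) a = 1 then (1 : ℝ) else 0) =
        (1 - (if a = 0 then 1 else 0) + quadraticChar (ZMod p) a) / 2 := by
      rcases hchar a with ⟨h, h'⟩ | ⟨h, h' | h'⟩ <;> rw [h'] <;> norm_num [h]
    simp_rw [this]
    rw [← Finset.sum_div, Finset.sum_add_distrib, Finset.sum_sub_distrib, hs, h0, hp]
    norm_num

/-- `legendreWeight` restricted to numbers not divisible by `p ^ 2`; it has mean zero. -/
noncomputable def localWeight (p : ℕ) [Fact p.Prime] (ε : ℤ) (n : ℕ) : ℝ :=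
  if p * p ∣ n then 0 else legendreWeight p ε n

theorem localWeight_periodic (p : ℕ) [Fact p.Prime] (ε : ℤ) :
    Function.Periodic (localWeight p ε) (p * p) := by
  intro n
  have h := (legendreWeight_periodic p ε).nat_mul p n
  simp only [Nat.cast_id] at h
  simp only [localWeight, Nat.dvd_add_self_right, h]

theorem sum_range_localWeight (p : ℕ) [hp : Fact p.Prime] (hodd : p ≠ 2) {ε : ℤ}
    (hε : ε = -1 ∨ ε = 0 ∨ ε = 1) :
    ∑ n ∈ Finset.range (p * p), localWeight p ε n = 0 := by
  have hpos : 0 < p * p := Nat.mul_pos hp.out.pos hp.out.pos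
  have h1 : ∑ n ∈ Finset.range (p * p), localWeight p ε n =
      ∑ n ∈ Finset.range (p * p), legendreWeight p ε n - legendreWeight p ε 0 := by
    rw [eq_sub_iff_add_eq, ← Finset.sum_ite_eq' (Finset.range (p * p)) 0
      (legendreWeight p ε) |>.trans (if_pos (Finset.mem_range.2 hpos)), ← Finset.sum_add_distrib]
    refine Finset.sum_congr rfl fun n hn => ?_
    rcases Nat.eq_zero_or_pos n with rfl | h
    · simp [localWeight]
    · simp [localWeight, h.ne', Nat.not_dvd_of_pos_of_lt h (Finset.mem_range.1 hn)]
  rw [h1, sum_range_mul_left_of_periodic (legendreWeight_periodic p ε)]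
  unfold legendreWeight
  rw [Finset.sum_sub_distrib, sum_range_legendreSym_eq p hodd hε]
  have : (0 : ℝ) ≤ p := p.cast_nonneg
  have h3 : (p : ℝ) + 1 ≠ 0 := by positivity
  have h4 : 2 * (p : ℝ) + 2 ≠ 0 := by positivity
  by_cases h : ε = 0
  · subst h
    simp [legendreDensity]
    field_simp
    ring
  · simp [legendreDensity, h, Ne.symm h]
    field_simp
    ring

/-- The condition at the prime `2` for a natural number to be a fundamental discriminant. -/
def AdmissibleAtTwo (n : ℕ) : Prop :=
  n % 4 = 1 ∨ n % 16 = 8 ∨ n % 16 = 12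

theorem admissibleAtTwo_add {n M : ℕ} (h : 16 ∣ M) :
    AdmissibleAtTwo (n + M) ↔ AdmissibleAtTwo n := by
  unfold AdmissibleAtTwo
  omega

theorem squarefree_iff_of_not_four_dvd {n : ℕ} (h : ¬ 4 ∣ n) :
    Squarefree n ↔ ∀ r : ℕ, r.Prime → r ≠ 2 → ¬ r * r ∣ n := by
  rw [Nat.squarefree_iff_prime_squarefree]
  refine ⟨fun H r hr _ => H r hr, fun H r hr hd => ?_⟩
  rcases eq_or_ne r 2 with rfl | h2
  · exact h hd
  · exact H r hr h2 hd

theorem isFundamentalDiscriminant_natCast_iff {n : ℕ} (hn : 1 < n) :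
    IsFundamentalDiscriminant n ↔
      AdmissibleAtTwo n ∧ ∀ r : ℕ, r.Prime → r ≠ 2 → ¬ r * r ∣ n := by
  have hn1 : (n : ℤ) ≠ 1 := by omega
  have hdiv : (n : ℤ) / 4 = ((n / 4 : ℕ) : ℤ) := by simp
  unfold IsFundamentalDiscriminant AdmissibleAtTwo
  rw [hdiv, Int.squarefree_natCast, Int.squarefree_natCast]
  by_cases h4 : 4 ∣ n
  · obtain ⟨m, rfl⟩ := h4
    have hm : 4 * m / 4 = m := by omega
    rw [hm]
    have hodd : (∀ r : ℕ, r.Prime → r ≠ 2 → ¬ r * r ∣ 4 * m) ↔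
        ∀ r : ℕ, r.Prime → r ≠ 2 → ¬ r * r ∣ m := by
      refine forall₃_congr fun r hr h2 => not_congr ?_
      have hc : Nat.Coprime r 2 := (Nat.coprime_primes hr Nat.prime_two).2 h2
      have hc4 : Nat.Coprime (r * r) 4 := (hc.mul_left hc).mul_right (hc.mul_left hc)
      exact hc4.dvd_mul_left
    rw [hodd]
    constructor
    · rintro ⟨-, ⟨h, -⟩ | ⟨-, hs, h⟩⟩
      · omega
      · exact ⟨by omega, (squarefree_iff_of_not_four_dvd (by omega)).1 hs⟩
    · rintro ⟨h, hs⟩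
      exact ⟨hn1, Or.inr ⟨by omega, (squarefree_iff_of_not_four_dvd (by omega)).2 hs, by omega⟩⟩
  · rw [← squarefree_iff_of_not_four_dvd h4]
    constructor
    · rintro ⟨-, ⟨h, hs⟩ | ⟨h, -⟩⟩
      · exact ⟨by omega, hs⟩
      · omega
    · rintro ⟨h, hs⟩
      exact ⟨hn1, Or.inl ⟨by omega, hs⟩⟩

open Classical in
/-- The indicator of the fundamental discriminants. -/
noncomputable def fundIndicator (n : ℕ) : ℝ :=
  if IsFundamentalDiscriminant n then 1 else 0

open Classical in
/-- The indicator of the numbers admissible at `2` and not divisible by `r ^ 2` for `r ∈ S`. -/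
noncomputable def sieveIndicator (S : Finset ℕ) (n : ℕ) : ℝ :=
  if AdmissibleAtTwo n ∧ ∀ r ∈ S, ¬ r * r ∣ n then 1 else 0

open Classical in
theorem sieveIndicator_periodic (S : Finset ℕ) :
    Function.Periodic (sieveIndicator S) (16 * ∏ r ∈ S, r * r) := by
  intro n
  unfold sieveIndicator
  refine if_congr (and_congr (admissibleAtTwo_add (Dvd.intro _ rfl))
    (forall₂_congr fun r hr => not_congr ?_)) rfl rfl
  exact (Nat.dvd_add_iff_left
    (Dvd.dvd.mul_left (Finset.dvd_prod_of_mem (fun r => r * r) hr) 16)).symm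

theorem sum_Ico_sum_dvd_le {ι : Type*} (R : Finset ι) (g : ι → ℕ) (N : ℕ) :
    ∑ n ∈ Finset.Ico 2 (N + 1), ∑ i ∈ R, (if g i * g i ∣ n then (1 : ℝ) else 0) ≤
      N * ∑ i ∈ R, ((g i : ℝ) ^ 2)⁻¹ := by
  rw [Finset.sum_comm, Finset.mul_sum]
  refine Finset.sum_le_sum fun i _ => ?_
  rw [Finset.sum_boole]
  calc (((Finset.Ico 2 (N + 1)).filter (g i * g i ∣ ·)).card : ℝ)
      ≤ (((Finset.Ioc 0 N).filter (g i * g i ∣ ·)).card : ℝ) := by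
        gcongr
        intro n hn
        simp only [Finset.mem_Ico, Finset.mem_Ioc] at hn ⊢
        omega
    _ = ((N / (g i * g i) : ℕ) : ℝ) := by rw [Nat.Ioc_filter_dvd_card_eq_div]
    _ ≤ (N : ℝ) / ((g i * g i : ℕ) : ℝ) := Nat.cast_div_le
    _ = N * ((g i : ℝ) ^ 2)⁻¹ := by push_cast; rw [div_eq_mul_inv, sq]

/-- The odd primes up to `K` other than `p`. -/
def sievingPrimes (p K : ℕ) : Finset ℕ :=
  (Finset.range (K + 1)).filter fun r => r.Prime ∧ r ≠ 2 ∧ r ≠ p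

theorem abs_fundIndicator_sub_le (p : ℕ) [hp : Fact p.Prime] (hodd : p ≠ 2) (ε : ℤ) (K : ℕ)
    {n N : ℕ} (hn : 1 < n) (hN : n ≤ N) :
    |legendreWeight p ε n * fundIndicator n -
        localWeight p ε n * sieveIndicator (sievingPrimes p K) n| ≤
      ∑ r ∈ Finset.Ioc K N, (if r * r ∣ n then (1 : ℝ) else 0) := by
  have hnonneg : ∀ r ∈ Finset.Ioc K N, (0 : ℝ) ≤ if r * r ∣ n then 1 else 0 := by
    intro r _
    split_ifs <;> norm_num
  unfold fundIndicator sieveIndicator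
  rw [isFundamentalDiscriminant_natCast_iff hn]
  by_cases hF : AdmissibleAtTwo n ∧ ∀ r : ℕ, r.Prime → r ≠ 2 → ¬ r * r ∣ n
  · have hS : AdmissibleAtTwo n ∧ ∀ r ∈ sievingPrimes p K, ¬ r * r ∣ n := by
      refine ⟨hF.1, fun r hr => ?_⟩
      simp only [sievingPrimes, Finset.mem_filter] at hr
      exact hF.2 r hr.2.1 hr.2.2.1
    rw [if_pos hF, if_pos hS, localWeight, if_neg (hF.2 p hp.out hodd)]
    simp
  · rw [if_neg hF]
    by_cases hS : AdmissibleAtTwo n ∧ ∀ r ∈ sievingPrimes p K, ¬ r * r ∣ n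
    · rw [if_pos hS, localWeight]
      split_ifs with hpn
      · simp
      · obtain ⟨r, hr, hr2, hd⟩ : ∃ r : ℕ, r.Prime ∧ r ≠ 2 ∧ r * r ∣ n := by
          by_contra! H
          exact hF ⟨hS.1, H⟩
        have hrp : r ≠ p := by
          rintro rfl
          exact hpn hd
        have hrK : K < r := by
          by_contra! H
          refine hS.2 r ?_ hd
          simp [sievingPrimes, hr, hr2, hrp]
          omega
        have hrN : r ≤ N :=
          (Nat.le_mul_self r).trans ((Nat.le_of_dvd (by omega) hd).trans hN)
        have h1 := Finset.single_le_sum hnonneg (Finset.mem_Ioc.2 ⟨hrK, hrN⟩)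
        rw [if_pos hd] at h1
        have h2 := abs_legendreWeight_le_one p ε n
        simpa using h2.trans h1
    · rw [if_neg hS]
      simp

theorem exists_abs_sum_localWeight_le (p : ℕ) [hp : Fact p.Prime] (hodd : p ≠ 2) {ε : ℤ}
    (hε : ε = -1 ∨ ε = 0 ∨ ε = 1) (K : ℕ) :
    ∃ C : ℝ, ∀ N : ℕ, |∑ n ∈ Finset.range N,
      localWeight p ε n * sieveIndicator (sievingPrimes p K) n| ≤ C := by
  have hpos : 0 < p * p := Nat.mul_pos hp.out.pos hp.out.pos
  set M := 16 * ∏ r ∈ sievingPrimes p K, r * r with hM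
  have hMpos : 0 < M := by
    refine Nat.mul_pos (by norm_num) (Finset.prod_pos fun r hr => ?_)
    simp only [sievingPrimes, Finset.mem_filter] at hr
    exact Nat.mul_pos hr.2.1.pos hr.2.1.pos
  have hcop : Nat.Coprime p M := by
    refine Nat.Coprime.mul_right ?_ (Nat.Coprime.prod_right fun r hr => ?_)
    · have : Nat.Coprime p (2 ^ 4) :=
        Nat.Coprime.pow_right _ ((Nat.coprime_primes hp.out Nat.prime_two).2 hodd)
      simpa using this
    · simp only [sievingPrimes, Finset.mem_filter] at hr
      have := (Nat.coprime_primes hp.out hr.2.1).2 hr.2.2.2.symm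
      exact this.mul_right this
  have hW := localWeight_periodic p ε
  have hS : Function.Periodic (sieveIndicator (sievingPrimes p K)) M := sieveIndicator_periodic _
  refine exists_abs_sum_range_le_of_periodic (T := p * p * M) (Nat.mul_pos hpos hMpos) ?_ ?_
  · intro n
    have h1 := hW.nat_mul M n
    have h2 := hS.nat_mul (p * p) n
    simp only [Nat.cast_id] at h1 h2
    rw [mul_comm M] at h1
    simp only [h1, h2]
  · rw [sum_range_mul_of_periodic hpos hMpos (hcop.mul_left hcop) hW hS,
      sum_range_localWeight p hodd hε, zero_mul]

theorem exists_abs_sum_fundIndicator_le (p : ℕ) [hp : Fact p.Prime] (hodd : p ≠ 2) {ε : ℤ}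
    (hε : ε = -1 ∨ ε = 0 ∨ ε = 1) {K : ℕ} (hK : K ≠ 0) :
    ∃ C : ℝ, ∀ N : ℕ, |∑ n ∈ Finset.Ico 2 (N + 1), legendreWeight p ε n * fundIndicator n| ≤
      N * (K : ℝ)⁻¹ + C := by
  obtain ⟨C, hC⟩ := exists_abs_sum_localWeight_le p hodd hε K
  have hC0 : 0 ≤ C := (abs_nonneg _).trans (hC 0)
  refine ⟨C + C, fun N => ?_⟩
  rcases Nat.eq_zero_or_pos N with rfl | hN
  · simpa using add_nonneg hC0 hC0
  have hmain : |∑ n ∈ Finset.Ico 2 (N + 1),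
      localWeight p ε n * sieveIndicator (sievingPrimes p K) n| ≤ C + C := by
    rw [Finset.sum_Ico_eq_sub _ (by omega)]
    exact (abs_sub _ _).trans (add_le_add (hC _) (hC _))
  have hdiff : |∑ n ∈ Finset.Ico 2 (N + 1), (legendreWeight p ε n * fundIndicator n -
      localWeight p ε n * sieveIndicator (sievingPrimes p K) n)| ≤ N * (K : ℝ)⁻¹ := by
    calc _ ≤ ∑ n ∈ Finset.Ico 2 (N + 1),
          ∑ r ∈ Finset.Ioc K N, (if r * r ∣ n then (1 : ℝ) else 0) := by
          refine (Finset.abs_sum_le_sum_abs _ _).trans (Finset.sum_le_sum fun n hn => ?_)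
          rw [Finset.mem_Ico] at hn
          exact abs_fundIndicator_sub_le p hodd ε K (by omega) (by omega)
      _ ≤ N * ∑ r ∈ Finset.Ioc K N, ((r : ℝ) ^ 2)⁻¹ := sum_Ico_sum_dvd_le _ _ N
      _ ≤ N * (K : ℝ)⁻¹ := by
          gcongr
          rcases le_total K N with h | h
          · refine (sum_Ioc_inv_sq_le_sub hK h).trans ?_
            rw [sub_le_self_iff]
            positivity
          · rw [Finset.Ioc_eq_empty_of_le h]
            simp
  rw [Finset.sum_sub_distrib] at hdiff
  rw [abs_le] at hmain hdiff ⊢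
  constructor <;> linarith [hmain.1, hmain.2, hdiff.1, hdiff.2]

theorem sum_range_inv_odd_sq_le (N : ℕ) :
    ∑ k ∈ Finset.range N, (((2 * k + 3 : ℕ) : ℝ) ^ 2)⁻¹ ≤ 1 / 4 := by
  have h : ∑ k ∈ Finset.range N, (((2 * k + 3 : ℕ) : ℝ) ^ 2)⁻¹ ≤
      1 / 4 - 1 / (4 * ((N : ℝ) + 1)) := by
    induction N with
    | zero => norm_num
    | succ N ih =>
      rw [Finset.sum_range_succ]
      have : (((2 * N + 3 : ℕ) : ℝ) ^ 2)⁻¹ ≤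
          1 / (4 * ((N : ℝ) + 1)) - 1 / (4 * (((N + 1 : ℕ) : ℝ) + 1)) := by
        push_cast
        rw [div_sub_div _ _ (by positivity) (by positivity), inv_eq_one_div,
          div_le_div_iff₀ (by positivity) (by positivity)]
        nlinarith [(N.cast_nonneg : (0 : ℝ) ≤ N)]
      linarith
  have : (0 : ℝ) ≤ 1 / (4 * ((N : ℝ) + 1)) := by positivity
  linarith

theorem sieveIndicator_empty_sub_le {n N : ℕ} (hn : 1 < n) (hN : n ≤ N) :
    sieveIndicator ∅ n - ∑ k ∈ Finset.range N,
      (if (2 * k + 3) * (2 * k + 3) ∣ n then (1 : ℝ) else 0) ≤ fundIndicator n := by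
  have hnonneg : ∀ k ∈ Finset.range N,
      (0 : ℝ) ≤ if (2 * k + 3) * (2 * k + 3) ∣ n then 1 else 0 := by
    intro r _
    split_ifs <;> norm_num
  have hsum := Finset.sum_nonneg hnonneg
  unfold fundIndicator sieveIndicator
  rw [isFundamentalDiscriminant_natCast_iff hn]
  split_ifs with h1 h2 h2
  · linarith
  · obtain ⟨r, hr, hr2, hd⟩ : ∃ r : ℕ, r.Prime ∧ r ≠ 2 ∧ r * r ∣ n := by
      by_contra! H
      exact h2 ⟨h1.1, H⟩
    obtain ⟨m, rfl⟩ := hr.odd_of_ne_two hr2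
    have hm : 1 ≤ m := by
      by_contra! H
      obtain rfl : m = 0 := by omega
      exact Nat.not_prime_one hr
    obtain ⟨k, rfl⟩ : ∃ k, m = k + 1 := ⟨m - 1, by omega⟩
    have hle : 2 * (k + 1) + 1 ≤ N :=
      (Nat.le_mul_self _).trans ((Nat.le_of_dvd (by omega) hd).trans hN)
    have h3 := Finset.single_le_sum hnonneg (Finset.mem_range.2 (by omega : k < N))
    rw [if_pos (show (2 * k + 3) * (2 * k + 3) ∣ n from hd)] at h3
    linarith
  · linarith
  · linarith

theorem exists_le_sum_fundIndicator :
    ∃ C : ℝ, ∀ N : ℕ, (N : ℝ) / 8 - C ≤ ∑ n ∈ Finset.Ico 2 (N + 1), fundIndicator n := by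
  have hper : Function.Periodic (fun n => sieveIndicator ∅ n - 3 / 8) 16 := by
    intro n
    have := sieveIndicator_periodic ∅ n
    simp only [Finset.prod_empty, mul_one] at this
    simp only [this]
  have hzero : ∑ n ∈ Finset.range 16, (sieveIndicator ∅ n - 3 / 8) = 0 := by
    simp only [Finset.sum_range_succ, Finset.sum_range_zero, sieveIndicator, AdmissibleAtTwo]
    norm_num
  obtain ⟨C, hC⟩ := exists_abs_sum_range_le_of_periodic (by norm_num) hper hzero
  have hC0 : 0 ≤ C := (abs_nonneg _).trans (hC 0)
  refine ⟨C + C + 3 / 8, fun N => ?_⟩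
  rcases Nat.eq_zero_or_pos N with rfl | hN
  · simp
    linarith
  have h1 : |∑ n ∈ Finset.Ico 2 (N + 1), (sieveIndicator ∅ n - 3 / 8)| ≤ C + C := by
    rw [Finset.sum_Ico_eq_sub _ (by omega)]
    exact (abs_sub _ _).trans (add_le_add (hC _) (hC _))
  have h2 := sum_Ico_sum_dvd_le (Finset.range N) (fun k => 2 * k + 3) N
  have h3 : (N : ℝ) * ∑ k ∈ Finset.range N, (((2 * k + 3 : ℕ) : ℝ) ^ 2)⁻¹ ≤ N * (1 / 4) := by
    gcongr
    exact sum_range_inv_odd_sq_le N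
  have h4 := Finset.sum_le_sum fun n (hn : n ∈ Finset.Ico 2 (N + 1)) =>
    sieveIndicator_empty_sub_le (by rw [Finset.mem_Ico] at hn; omega : 1 < n)
      (by rw [Finset.mem_Ico] at hn; omega : n ≤ N)
  rw [Finset.sum_sub_distrib] at h1 h4
  have hcard : ((N + 1 - 2 : ℕ) : ℝ) = N - 1 := by
    rw [show N + 1 - 2 = N - 1 by omega, Nat.cast_pred hN]
  simp only [Finset.sum_const, Nat.card_Ico, nsmul_eq_mul, hcard] at h1
  rw [abs_le] at h1
  linarith [h1.1]

theorem tendsto_div_of_forall_abs_le {E : ℕ → ℝ}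
    (hE : ∀ K : ℕ, K ≠ 0 → ∃ C, ∀ N : ℕ, |E N| ≤ N * (K : ℝ)⁻¹ + C) {G : ℕ → ℝ}
    (hG : ∃ C : ℝ, ∀ N : ℕ, (N : ℝ) / 8 - C ≤ G N) :
    Tendsto (fun N => E N / G N) atTop (nhds 0) := by
  obtain ⟨B, hB⟩ := hG
  rw [Metric.tendsto_atTop]
  intro δ hδ
  obtain ⟨k, hk⟩ := exists_nat_gt (32 / δ)
  have hk0 : (0 : ℝ) < k := lt_trans (by positivity) hk
  obtain ⟨C, hC⟩ := hE k (by rintro rfl; simp at hk0)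
  have hkinv : (k : ℝ)⁻¹ ≤ δ / 32 := by
    rw [inv_le_comm₀ hk0 (by positivity), inv_div]
    exact hk.le
  obtain ⟨N₀, hN₀⟩ := exists_nat_gt (max (16 * |B|) (32 * |C| / δ))
  refine ⟨N₀, fun N hN => ?_⟩
  have hNN : (N₀ : ℝ) ≤ N := by exact_mod_cast hN
  have h1 : 16 * |B| < N := ((le_max_left _ _).trans_lt hN₀).trans_le hNN
  have h2 : 32 * |C| / δ < N := ((le_max_right _ _).trans_lt hN₀).trans_le hNN
  rw [div_lt_iff₀ hδ] at h2
  have hNpos : (0 : ℝ) < N := lt_of_le_of_lt (by positivity) h1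
  have hGN : (N : ℝ) / 16 ≤ G N := by linarith [hB N, le_abs_self B]
  have hGpos : 0 < G N := by linarith
  rw [Real.dist_eq, sub_zero, abs_div, abs_of_pos hGpos, div_lt_iff₀ hGpos]
  have h3 : (N : ℝ) * (k : ℝ)⁻¹ ≤ N * (δ / 32) := by gcongr
  have h4 : δ * (N / 16) ≤ δ * G N := by gcongr
  nlinarith [hC N, le_abs_self C]

theorem ncard_int_eq_card_filter (P : ℤ → Prop) [DecidablePred P] (x : ℝ) (hx : 0 ≤ x) :
    {D : ℤ | 1 < D ∧ (D : ℝ) ≤ x ∧ P D}.ncard =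
      ((Finset.Ico 2 (⌊x⌋₊ + 1)).filter fun n : ℕ => P n).card := by
  rw [← Set.ncard_coe_finset, ← Set.ncard_image_of_injective _ (Nat.cast_injective (R := ℤ))]
  congr 1
  ext D
  simp only [Set.mem_ofPred_eq, Finset.coe_filter, Finset.mem_Ico, Set.mem_image]
  constructor
  · rintro ⟨h1, h2, h3⟩
    lift D to ℕ using by omega
    have : D ≤ ⌊x⌋₊ := Nat.le_floor (by exact_mod_cast h2)
    exact ⟨D, ⟨⟨by omega, by omega⟩, h3⟩, rfl⟩
  · rintro ⟨n, ⟨⟨h1, h2⟩, h3⟩, rfl⟩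
    refine ⟨by omega, ?_, h3⟩
    have := (Nat.le_floor_iff hx).1 (Nat.lt_succ_iff.1 h2)
    exact_mod_cast this

/-- For an odd prime `p` and `ε ∈ {-1,0,1}`, the proportion of fundamental discriminants
`1 < D ≤ x` with Legendre symbol `(D|p) = ε` converges to `p/(2p+2)` if `ε = ±1` and to
`1/(p+1)` if `ε = 0`. -/
theorem stmt_4 (p : ℕ) [hp : Fact p.Prime] (hodd : p ≠ 2) (ε : ℤ)
    (hε : ε = -1 ∨ ε = 0 ∨ ε = 1) :
    Tendsto (fun x : ℝ =>
        ({D : ℤ | IsFundamentalDiscriminant D ∧ 1 < D ∧ (D : ℝ) ≤ x ∧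
            legendreSym p D = ε}.ncard : ℝ) /
        ({D : ℤ | IsFundamentalDiscriminant D ∧ 1 < D ∧ (D : ℝ) ≤ x}.ncard : ℝ))
      atTop (nhds (if ε = 0 then 1 / ((p : ℝ) + 1) else (p : ℝ) / (2 * p + 2))) := by
  classical
  set L := legendreDensity p ε with hL
  have hE := tendsto_div_of_forall_abs_le
    (E := fun N => ∑ n ∈ Finset.Ico 2 (N + 1), legendreWeight p ε n * fundIndicator n)
    (fun K hK => exists_abs_sum_fundIndicator_le p hodd hε (K := K) hK) exists_le_sum_fundIndicator
  have hE' := (hE.comp (tendsto_nat_floor_atTop (α := ℝ))).add_const L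
  rw [zero_add] at hE'
  refine Tendsto.congr' ?_ hE'
  obtain ⟨B, hB⟩ := exists_le_sum_fundIndicator
  filter_upwards [eventually_ge_atTop 0,
    (tendsto_nat_floor_atTop (α := ℝ)).eventually_gt_atTop ⌈8 * |B|⌉₊] with x hx hxB
  have hden : {D : ℤ | IsFundamentalDiscriminant D ∧ 1 < D ∧ (D : ℝ) ≤ x} =
      {D : ℤ | 1 < D ∧ (D : ℝ) ≤ x ∧ IsFundamentalDiscriminant D} := by
    ext D
    simp only [Set.mem_ofPred_eq]
    tauto
  have hnum : {D : ℤ | IsFundamentalDiscriminant D ∧ 1 < D ∧ (D : ℝ) ≤ x ∧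
        legendreSym p D = ε} =
      {D : ℤ | 1 < D ∧ (D : ℝ) ≤ x ∧ (IsFundamentalDiscriminant D ∧ legendreSym p D = ε)} := by
    ext D
    simp only [Set.mem_ofPred_eq]
    tauto
  rw [hden, hnum, ncard_int_eq_card_filter _ x hx, ncard_int_eq_card_filter _ x hx,
    ← Finset.sum_boole, ← Finset.sum_boole]
  have hG : 0 < ∑ n ∈ Finset.Ico 2 (⌊x⌋₊ + 1), fundIndicator n := by
    have h1 := (Nat.le_ceil (8 * |B|)).trans_lt (Nat.cast_lt.2 hxB)
    linarith [hB ⌊x⌋₊, le_abs_self B]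
  have hsplit : ∑ n ∈ Finset.Ico 2 (⌊x⌋₊ + 1), legendreWeight p ε n * fundIndicator n =
      ∑ n ∈ Finset.Ico 2 (⌊x⌋₊ + 1),
        (if IsFundamentalDiscriminant n ∧ legendreSym p n = ε then (1 : ℝ) else 0) -
      L * ∑ n ∈ Finset.Ico 2 (⌊x⌋₊ + 1), fundIndicator n := by
    rw [Finset.mul_sum, ← Finset.sum_sub_distrib]
    refine Finset.sum_congr rfl fun n _ => ?_
    by_cases h1 : IsFundamentalDiscriminant n <;> by_cases h2 : legendreSym p n = ε <;>
      simp [legendreWeight, fundIndicator, h1, h2, hL]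
  simp only [Function.comp_apply]
  rw [hsplit, sub_div, mul_div_assoc, div_self hG.ne', mul_one, sub_add_cancel]
  rfl
end

section
/- Let p₁, …, p_ℓ be distinct odd primes and let ε₁, …, ε_ℓ ∈ {−1, 0, 1}. For x > 0 let 𝒟(x) be the set of pairs (D₁, D₂) of fundamental discriminants with D₁ > 1, D₂ > 1 and D₁D₂ ≤ x, and let A(x) ⊆ 𝒟(x) be the set of pairs such that for each i = 1, …, ℓ: if (D₂|p_i) ≠ 0 then (D₂|p_i) = ε_i, while if (D₂|p_i) = 0 then (D₁|p_i) = ε_i (this condition says exactly that the sign of the p_i-th Fourier coefficient σ_{χ₁,χ₂}^{k-1}(p_i) of the Eisenstein newform attached to the quadratic characters χ₁, χ₂ of discriminants D₁, D₂ equals ε_i). Then #A(x) / #𝒟(x) → (∏_{i : ε_i = 0} 1/(p_i+1)²) · (∏_{i : ε_i ≠ 0} p_i(p_i+2)/(2(p_i+1)²)) as x → ∞. -/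
open Filter

open Topology

/-- The mean value of `f` over `1, …, N` tends to `c`. -/
def HasMean (f : ℕ → ℝ) (c : ℝ) : Prop :=
  Tendsto (fun N : ℕ => (∑ n ∈ Finset.Ioc 0 N, f n) / N) atTop (𝓝 c)

/-- Every square divisor of `n` prime to `M` is trivial. -/
def SquarefreeAway (M n : ℕ) : Prop :=
  ∀ d : ℕ, d.Coprime M → d ^ 2 ∣ n → d = 1

/-- The Möbius function restricted to arguments prime to `M`. -/
noncomputable def moebiusAway (M d : ℕ) : ℝ :=
  if d.Coprime M then (ArithmeticFunction.moebius d : ℝ) else 0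

/-- The sum `∑ μ(d) / d²` over `d` prime to `M`. -/
noncomputable def squarefreeConst (M : ℕ) : ℝ :=
  ∑' d : ℕ, moebiusAway M d / (d : ℝ) ^ 2

lemma abs_moebiusAway_le_one (M d : ℕ) : |moebiusAway M d| ≤ 1 := by
  unfold moebiusAway
  split_ifs
  · exact_mod_cast ArithmeticFunction.abs_moebius_le_one
  · simp

lemma abs_moebiusAway_div_sq_le (M d : ℕ) :
    |moebiusAway M d / (d : ℝ) ^ 2| ≤ 1 / (d : ℝ) ^ 2 := by
  rw [abs_div, abs_of_nonneg (sq_nonneg (d : ℝ))]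
  exact div_le_div_of_nonneg_right (abs_moebiusAway_le_one M d) (sq_nonneg _)

lemma squarefreeConst_pos (M : ℕ) : 0 < squarefreeConst M := by
  have hs : Summable fun d : ℕ => 1 / (d : ℝ) ^ 2 := hasSum_zeta_two.summable
  have hm : Summable fun d : ℕ => moebiusAway M d / (d : ℝ) ^ 2 :=
    Summable.of_norm_bounded hs fun d => abs_moebiusAway_div_sq_le M d
  have h1 := (hm.add hs).le_tsum 1 fun d _ => by
    have := neg_le_of_abs_le (abs_moebiusAway_div_sq_le M d)
    linarith
  rw [hm.tsum_add hs, hasSum_zeta_two.tsum_eq] at h1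
  have h2 : moebiusAway M 1 = 1 := by simp [moebiusAway]
  simp only [h2, Nat.cast_one] at h1
  have h3 := Real.pi_lt_d2
  have h4 := Real.pi_pos
  unfold squarefreeConst
  nlinarith

lemma exists_greatest_square_divisor (M : ℕ) {n : ℕ} (hn : 0 < n) :
    ∃ b : ℕ, 0 < b ∧ b ≤ n ∧ ∀ d : ℕ, d ∣ b ↔ d.Coprime M ∧ d ^ 2 ∣ n := by
  classical
  obtain ⟨b, hb, hmax⟩ := Finset.exists_max_image
    ((Finset.Ioc 0 n).filter fun d => d.Coprime M ∧ d ^ 2 ∣ n) id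
    ⟨1, by simp; omega⟩
  simp only [Finset.mem_filter, Finset.mem_Ioc, id] at hb hmax
  refine ⟨b, hb.1.1, hb.1.2, fun d => ⟨fun h => ⟨hb.2.1.coprime_dvd_left h,
    (pow_dvd_pow_of_dvd h 2).trans hb.2.2⟩, fun ⟨h1, h2⟩ => ?_⟩⟩
  have hl : (d.lcm b) ^ 2 ∣ n := by
    rw [← Nat.pow_lcm_pow]
    exact Nat.lcm_dvd h2 hb.2.2
  have hc : (d.lcm b).Coprime M :=
    Nat.Coprime.coprime_dvd_left (Nat.lcm_dvd_mul d b) (h1.mul_left hb.2.1)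
  have hpos : 0 < d.lcm b := by
    rcases Nat.eq_zero_or_pos (d.lcm b) with h | h
    · rw [h] at hl
      simp at hl
      omega
    · exact h
  have hle : d.lcm b ≤ n := (Nat.le_self_pow two_ne_zero _).trans (Nat.le_of_dvd hn hl)
  have := hmax (d.lcm b) ⟨⟨hpos, hle⟩, hc, hl⟩
  have heq : d.lcm b = b := le_antisymm this (Nat.le_of_dvd hpos (Nat.dvd_lcm_right d b))
  exact heq ▸ Nat.dvd_lcm_left d b

open scoped Classical in
lemma sum_moebiusAway (M : ℕ) {n N : ℕ} (hn : 0 < n) (hN : n ≤ N) :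
    ∑ d ∈ Finset.Ioc 0 N, (if d ^ 2 ∣ n then moebiusAway M d else 0) =
      if SquarefreeAway M n then 1 else 0 := by
  obtain ⟨b, hb, hbn, h⟩ := exists_greatest_square_divisor M hn
  have h1 : SquarefreeAway M n ↔ b = 1 := by
    constructor
    · intro hs
      exact hs b ((h b).1 dvd_rfl).1 ((h b).1 dvd_rfl).2
    · rintro rfl d hd1 hd2
      exact Nat.dvd_one.1 ((h d).2 ⟨hd1, hd2⟩)
  have h2 : (Finset.Ioc 0 N).filter (fun d => d ^ 2 ∣ n ∧ d.Coprime M) = b.divisors := by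
    ext d
    simp only [Finset.mem_filter, Finset.mem_Ioc, Nat.mem_divisors]
    constructor
    · rintro ⟨-, h3, h4⟩
      exact ⟨(h d).2 ⟨h4, h3⟩, hb.ne'⟩
    · rintro ⟨h3, -⟩
      exact ⟨⟨Nat.pos_of_dvd_of_pos h3 hb, (Nat.le_of_dvd hb h3).trans (hbn.trans hN)⟩,
        ((h d).1 h3).2, ((h d).1 h3).1⟩
  have h3 : ∑ d ∈ Finset.Ioc 0 N, (if d ^ 2 ∣ n then moebiusAway M d else 0) =
      ∑ d ∈ b.divisors, (ArithmeticFunction.moebius d : ℝ) := by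
    rw [← h2, Finset.sum_filter]
    refine Finset.sum_congr rfl fun d _ => ?_
    unfold moebiusAway
    split_ifs <;> simp_all
  have h4 := ArithmeticFunction.coe_mul_zeta_apply (f := ArithmeticFunction.moebius) (x := b)
  rw [ArithmeticFunction.moebius_mul_coe_zeta, ArithmeticFunction.one_apply] at h4
  rw [h3, ← Int.cast_sum, ← h4]
  simp [h1]

lemma tendsto_card_modEq_div {r : ℕ} (hr : 0 < r) (v : ℕ) :
    Tendsto (fun N : ℕ => (((Finset.Ioc 0 N).filter fun n => n ≡ v [MOD r]).card : ℝ) / N)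
      atTop (𝓝 (1 / r)) := by
  have key : ∀ N : ℕ,
      |(((Finset.Ioc 0 N).filter fun n => n ≡ v [MOD r]).card : ℝ) - N / r| ≤ 1 := by
    intro N
    have h := Nat.Ioc_filter_modEq_card 0 N hr v
    have hr' : (0 : ℚ) < r := by exact_mod_cast hr
    have hle : ⌊(((0 : ℕ) : ℚ) - v) / r⌋ ≤ ⌊((N : ℚ) - v) / r⌋ := by
      apply Int.floor_le_floor
      gcongr
      simp
    rw [max_eq_left (by omega)] at h
    have h' : (((Finset.Ioc 0 N).filter fun n => n ≡ v [MOD r]).card : ℚ) =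
        (⌊((N : ℚ) - v) / r⌋ : ℚ) - ⌊(((0 : ℕ) : ℚ) - v) / r⌋ := by exact_mod_cast h
    have h1 := Int.floor_le (((N : ℚ) - v) / r)
    have h2 := Int.lt_floor_add_one (((N : ℚ) - v) / r)
    have h3 := Int.floor_le ((((0 : ℕ) : ℚ) - v) / r)
    have h4 := Int.lt_floor_add_one ((((0 : ℕ) : ℚ) - v) / r)
    have h5 : ((N : ℚ) - v) / r - (((0 : ℕ) : ℚ) - v) / r = N / r := by
      field_simp
      simp
    have : |(((Finset.Ioc 0 N).filter fun n => n ≡ v [MOD r]).card : ℚ) - N / r| ≤ 1 := by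
      rw [abs_le]
      constructor <;> linarith
    have h6 := (Rat.cast_le (K := ℝ)).2 this
    push_cast at h6
    exact h6
  have h0 : Tendsto (fun N : ℕ => 1 / (N : ℝ)) atTop (𝓝 0) := tendsto_one_div_atTop_nhds_zero_nat
  rw [tendsto_iff_norm_sub_tendsto_zero]
  refine squeeze_zero' (Eventually.of_forall fun _ => norm_nonneg _) ?_ h0
  filter_upwards [eventually_gt_atTop 0] with N hN
  have hN' : (0 : ℝ) < N := by exact_mod_cast hN
  have : (((Finset.Ioc 0 N).filter fun n => n ≡ v [MOD r]).card : ℝ) / N - 1 / r =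
      ((((Finset.Ioc 0 N).filter fun n => n ≡ v [MOD r]).card : ℝ) - N / r) / N := by
    field_simp
  rw [this, Real.norm_eq_abs, abs_div, abs_of_pos hN']
  gcongr
  exact key N

open scoped Classical in
lemma tendsto_card_class_sq_dvd {M d : ℕ} (hM : 0 < M) (hd : 0 < d) (hc : d.Coprime M)
    (a : ZMod M) :
    Tendsto (fun N : ℕ =>
        (((Finset.Ioc 0 N).filter fun n => d ^ 2 ∣ n ∧ (n : ZMod M) = a).card : ℝ) / N)
      atTop (𝓝 (1 / (M * (d : ℝ) ^ 2))) := by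
  have : NeZero M := ⟨hM.ne'⟩
  obtain ⟨v, hv1, hv2⟩ := Nat.chineseRemainder (hc.pow_left 2) 0 a.val
  have h := tendsto_card_modEq_div (r := d ^ 2 * M) (by positivity) v
  have hl : (1 : ℝ) / ((d ^ 2 * M : ℕ) : ℝ) = 1 / (M * (d : ℝ) ^ 2) := by
    push_cast
    ring
  rw [hl] at h
  refine h.congr fun N => ?_
  congr 3
  ext n
  rw [Finset.mem_filter, Finset.mem_filter, ← Nat.modEq_and_modEq_iff_modEq_mul (hc.pow_left 2)]
  refine and_congr_right fun _ => and_congr ⟨fun h => (Nat.modEq_zero_iff_dvd).1 (h.trans hv1),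
    fun h => ((Nat.modEq_zero_iff_dvd).2 h).trans hv1.symm⟩ ?_
  rw [← ZMod.natCast_eq_natCast_iff]
  have hv : (v : ZMod M) = a := by
    rw [(ZMod.natCast_eq_natCast_iff _ _ _).2 hv2, ZMod.natCast_zmod_val]
  rw [hv]

open scoped Classical in
lemma hasMean_squarefreeAway {M : ℕ} (hM : 0 < M) (a : ZMod M) :
    HasMean (fun n => if SquarefreeAway M n ∧ (n : ZMod M) = a then 1 else 0)
      (squarefreeConst M / M) := by
  have hs : Summable fun d : ℕ => 1 / (d : ℝ) ^ 2 := hasSum_zeta_two.summable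
  have hb : ∀ N d : ℕ,
      (((Finset.Ioc 0 N).filter fun n => d ^ 2 ∣ n ∧ (n : ZMod M) = a).card : ℝ) / N ≤
        1 / (d : ℝ) ^ 2 := by
    intro N d
    have h1 : ((Finset.Ioc 0 N).filter fun n => d ^ 2 ∣ n ∧ (n : ZMod M) = a).card ≤ N / d ^ 2 := by
      rw [← Nat.Ioc_filter_dvd_card_eq_div]
      exact Finset.card_le_card fun n hn => by
        simp only [Finset.mem_filter] at hn ⊢
        exact ⟨hn.1, hn.2.1⟩
    have h2 : (((Finset.Ioc 0 N).filter fun n => d ^ 2 ∣ n ∧ (n : ZMod M) = a).card : ℝ) ≤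
        N / (d : ℝ) ^ 2 := by
      refine (Nat.cast_le.2 h1).trans ?_
      exact_mod_cast Nat.cast_div_le (α := ℝ) (m := N) (n := d ^ 2)
    rcases Nat.eq_zero_or_pos N with rfl | hN
    · simp
    · have hN' : (0 : ℝ) < N := by exact_mod_cast hN
      rw [div_le_iff₀ hN']
      refine h2.trans (le_of_eq ?_)
      ring
  have hT := tendsto_tsum_of_dominated_convergence (𝓕 := atTop)
    (f := fun (N d : ℕ) => moebiusAway M d *
      ((((Finset.Ioc 0 N).filter fun n => d ^ 2 ∣ n ∧ (n : ZMod M) = a).card : ℝ) / N))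
    (g := fun d => moebiusAway M d / (d : ℝ) ^ 2 / M) hs ?_ ?_
  · rw [tsum_div_const] at hT
    refine hT.congr fun N => ?_
    rw [tsum_eq_sum (s := Finset.Ioc 0 N), Finset.sum_div]
    · simp only [← Finset.sum_boole, ← mul_div_assoc]
      rw [← Finset.sum_div, ← Finset.sum_div]
      congr 1
      simp only [Finset.mul_sum]
      rw [Finset.sum_comm]
      refine Finset.sum_congr rfl fun n hn => ?_
      rw [Finset.mem_Ioc] at hn
      by_cases ha : (n : ZMod M) = a
      · simp only [ha, and_true, ← sum_moebiusAway M hn.1 hn.2, mul_ite, mul_one, mul_zero]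
      · simp [ha]
    · intro d hd
      rw [Finset.mem_Ioc, not_and_or] at hd
      rcases hd with hd | hd
      · obtain rfl : d = 0 := by omega
        simp [moebiusAway]
      · rw [Finset.filter_false_of_mem, Finset.card_empty]
        · simp
        · rintro n hn ⟨h1, -⟩
          rw [Finset.mem_Ioc] at hn
          have := Nat.le_of_dvd hn.1 h1
          have := Nat.le_self_pow two_ne_zero d
          omega
  · intro d
    rcases Nat.eq_zero_or_pos d with rfl | hd
    · simp [moebiusAway]
    by_cases hc : d.Coprime M
    · have := (tendsto_card_class_sq_dvd hM hd hc a).const_mul (moebiusAway M d)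
      convert this using 2
      have : (0 : ℝ) < M := by exact_mod_cast hM
      have : (0 : ℝ) < d := by exact_mod_cast hd
      field_simp
    · simp [moebiusAway, hc]
  · refine Eventually.of_forall fun N d => ?_
    rw [norm_mul, Real.norm_eq_abs, Real.norm_of_nonneg (by positivity)]
    exact (mul_le_of_le_one_left (by positivity) (abs_moebiusAway_le_one M d)).trans (hb N d)

lemma sum_Ioc_div_eq (f : ℕ → ℝ) (N : ℕ) :
    ∑ n ∈ Finset.Ioc 0 N, f n / n = (∑ n ∈ Finset.Ioc 0 N, f n) / N +
      ∑ n ∈ Finset.range N, (∑ k ∈ Finset.Ioc 0 n, f k) / n * (1 / ((n : ℝ) + 1)) := by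
  induction N with
  | zero => simp
  | succ N ih =>
    rw [Finset.sum_Ioc_succ_top (Nat.zero_le N), Finset.sum_range_succ, ih,
      Finset.sum_Ioc_succ_top (Nat.zero_le N)]
    rcases Nat.eq_zero_or_pos N with rfl | hN
    · simp
    · have hN' : (0 : ℝ) < N := by exact_mod_cast hN
      push_cast
      field_simp
      ring

/-- The real harmonic number `∑ 1 / a`. -/
noncomputable def harmonicSum (N : ℕ) : ℝ := ∑ n ∈ Finset.range N, 1 / ((n : ℝ) + 1)

lemma tendsto_harmonicSum : Tendsto harmonicSum atTop atTop :=
  Real.tendsto_sum_range_one_div_nat_succ_atTop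

lemma sum_Ioc_one_div (N : ℕ) : ∑ n ∈ Finset.Ioc 0 N, 1 / (n : ℝ) = harmonicSum N := by
  unfold harmonicSum
  induction N with
  | zero => simp
  | succ N ih =>
    rw [Finset.sum_Ioc_succ_top (Nat.zero_le N), Finset.sum_range_succ, ih]
    push_cast
    rfl

lemma HasMean.tendsto_sum_div {f : ℕ → ℝ} {s : ℝ} (hf : HasMean f s) :
    Tendsto (fun N : ℕ => (∑ n ∈ Finset.Ioc 0 N, f n / n) / harmonicSum N) atTop (𝓝 s) := by
  have h1 : (fun n : ℕ => ((∑ k ∈ Finset.Ioc 0 n, f k) / n - s) * (1 / ((n : ℝ) + 1))) =o[atTop]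
      fun n : ℕ => 1 / ((n : ℝ) + 1) := by
    have h : (fun n : ℕ => (∑ k ∈ Finset.Ioc 0 n, f k) / n - s) =o[atTop] fun _ => (1 : ℝ) := by
      rw [Asymptotics.isLittleO_one_iff]
      simpa using hf.sub_const s
    simpa using h.mul_isBigO (Asymptotics.isBigO_refl (fun n : ℕ => 1 / ((n : ℝ) + 1)) atTop)
  have h2 := (h1.sum_range (fun n => by positivity) tendsto_harmonicSum).tendsto_div_nhds_zero
  have h3 : Tendsto (fun N : ℕ => (∑ n ∈ Finset.Ioc 0 N, f n) / N / harmonicSum N) atTop (𝓝 0) :=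
    Tendsto.div_atTop hf tendsto_harmonicSum
  have h4 := (h3.add h2).add_const s
  simp only [zero_add] at h4
  refine h4.congr' ?_
  filter_upwards [tendsto_harmonicSum.eventually_gt_atTop 0] with N hN
  rw [sum_Ioc_div_eq]
  simp only [sub_mul, Finset.sum_sub_distrib, ← Finset.mul_sum]
  change _ + (_ - s * harmonicSum N) / harmonicSum N + s = _
  field_simp
  ring

lemma HasMean.exists_abs_sum_sub_le {g : ℕ → ℝ} {t : ℝ} (hg : HasMean g t) {δ : ℝ} (hδ : 0 < δ) :
    ∃ C : ℝ, ∀ n : ℕ, |∑ k ∈ Finset.Ioc 0 n, g k - t * n| ≤ δ * n + C := by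
  obtain ⟨n₀, h⟩ := Metric.tendsto_atTop.1 hg δ hδ
  refine ⟨∑ m ∈ Finset.range (n₀ + 1), |∑ k ∈ Finset.Ioc 0 m, g k - t * m|, fun n => ?_⟩
  rcases le_or_gt n n₀ with hn | hn
  · have := Finset.single_le_sum (f := fun m : ℕ => |∑ k ∈ Finset.Ioc 0 m, g k - t * m|)
      (fun m _ => abs_nonneg _) (Finset.mem_range.2 (Nat.lt_succ_of_le hn))
    have h0 : 0 ≤ δ * n := by positivity
    linarith
  · have hn' : (0 : ℝ) < n := by exact_mod_cast (Nat.zero_le n₀).trans_lt hn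
    have h1 := h n hn.le
    rw [Real.dist_eq] at h1
    have h2 : ∑ k ∈ Finset.Ioc 0 n, g k - t * n = ((∑ k ∈ Finset.Ioc 0 n, g k) / n - t) * n := by
      field_simp
    have h3 : (0 : ℝ) ≤ ∑ m ∈ Finset.range (n₀ + 1), |∑ k ∈ Finset.Ioc 0 m, g k - t * m| :=
      Finset.sum_nonneg fun _ _ => abs_nonneg _
    rw [h2, abs_mul, abs_of_pos hn']
    nlinarith

lemma HasMean.tendsto_sum_mul {f g : ℕ → ℝ} {s t : ℝ} (hf1 : ∀ n, |f n| ≤ 1) (hf : HasMean f s)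
    (hg : HasMean g t) :
    Tendsto (fun N : ℕ => (∑ a ∈ Finset.Ioc 0 N, f a * ∑ b ∈ Finset.Ioc 0 (N / a), g b) /
      (N * harmonicSum N)) atTop (𝓝 (s * t)) := by
  have hmain := hf.tendsto_sum_div.mul_const t
  have herr : Tendsto (fun N : ℕ => (∑ a ∈ Finset.Ioc 0 N,
      f a * (∑ b ∈ Finset.Ioc 0 (N / a), g b - t * (N / a))) / (N * harmonicSum N))
      atTop (𝓝 0) := by
    rw [Metric.tendsto_nhds]
    intro δ hδ
    obtain ⟨C, hC⟩ := hg.exists_abs_sum_sub_le (half_pos hδ)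
    have hlim : Tendsto (fun N => (C + |t|) / harmonicSum N) atTop (𝓝 0) :=
      tendsto_const_nhds.div_atTop tendsto_harmonicSum
    filter_upwards [eventually_gt_atTop 0, tendsto_harmonicSum.eventually_gt_atTop 0,
      hlim.eventually_lt_const (half_pos hδ)] with N hN hH hlt
    have hN' : (0 : ℝ) < N := by exact_mod_cast hN
    rw [Real.dist_0_eq_abs, abs_div, abs_of_pos (mul_pos hN' hH), div_lt_iff₀ (mul_pos hN' hH)]
    have hterm : ∀ a ∈ Finset.Ioc 0 N,
        |f a * (∑ b ∈ Finset.Ioc 0 (N / a), g b - t * (N / a))| ≤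
          δ / 2 * N * (1 / a) + (C + |t|) := by
      intro a ha
      rw [Finset.mem_Ioc] at ha
      have ha' : (0 : ℝ) < a := by exact_mod_cast ha.1
      have h1 : ((N / a : ℕ) : ℝ) ≤ N / a := Nat.cast_div_le
      have h2 : (N : ℝ) / a ≤ ((N / a : ℕ) : ℝ) + 1 := by
        rw [div_le_iff₀ ha']
        have := Nat.lt_div_mul_add ha.1 (a := N)
        have h : N ≤ (N / a + 1) * a := by nlinarith
        exact_mod_cast h
      have h3 : |t * ((N / a : ℕ) : ℝ) - t * (N / a)| ≤ |t| := by
        rw [← mul_sub, abs_mul]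
        refine mul_le_of_le_one_right (abs_nonneg t) ?_
        rw [abs_le]
        constructor <;> linarith
      have h4 := abs_sub_le (∑ b ∈ Finset.Ioc 0 (N / a), g b) (t * ((N / a : ℕ) : ℝ)) (t * (N / a))
      have h5 : δ / 2 * ((N / a : ℕ) : ℝ) ≤ δ / 2 * N * (1 / a) := by
        rw [mul_assoc, mul_one_div]
        gcongr
      rw [abs_mul]
      refine (mul_le_of_le_one_left (abs_nonneg _) (hf1 a)).trans ?_
      linarith [hC (N / a)]
    refine ((Finset.abs_sum_le_sum_abs _ _).trans (Finset.sum_le_sum hterm)).trans_lt ?_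
    rw [Finset.sum_add_distrib, ← Finset.mul_sum, sum_Ioc_one_div, Finset.sum_const, Nat.card_Ioc,
      nsmul_eq_mul, Nat.sub_zero]
    rw [div_lt_iff₀ hH] at hlt
    nlinarith
  have h := hmain.add herr
  rw [add_zero] at h
  refine h.congr' ?_
  filter_upwards [eventually_gt_atTop 0, tendsto_harmonicSum.eventually_gt_atTop 0] with N hN hH
  have hN' : (0 : ℝ) < N := by exact_mod_cast hN
  have h1 : ∑ a ∈ Finset.Ioc 0 N, f a * ∑ b ∈ Finset.Ioc 0 (N / a), g b =
      N * t * (∑ a ∈ Finset.Ioc 0 N, f a / a) + ∑ a ∈ Finset.Ioc 0 N,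
        f a * (∑ b ∈ Finset.Ioc 0 (N / a), g b - t * (N / a)) := by
    rw [Finset.mul_sum, ← Finset.sum_add_distrib]
    refine Finset.sum_congr rfl fun a _ => ?_
    ring
  rw [h1]
  field_simp

lemma HasMean.congr_of_one_lt {f g : ℕ → ℝ} {c : ℝ} (hf : HasMean f c)
    (h : ∀ n, 1 < n → g n = f n) :
    HasMean g c := by
  have h0 : Tendsto (fun N : ℕ => (g 1 - f 1) / (N : ℝ)) atTop (𝓝 0) :=
    tendsto_const_div_atTop_nhds_zero_nat _
  have h1 := hf.add h0
  rw [add_zero] at h1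
  refine h1.congr' ?_
  filter_upwards [eventually_ge_atTop 1] with N hN
  rw [← add_div]
  congr 1
  induction N, hN using Nat.le_induction with
  | base => simp
  | succ N hN ih =>
    rw [Finset.sum_Ioc_succ_top (Nat.zero_le N), Finset.sum_Ioc_succ_top (Nat.zero_le N),
      h (N + 1) (by omega), ← ih]
    ring

open scoped Classical in
/-- The indicator function of the integers `n > 1` in the class `a` modulo `M` which are squarefree
away from `M`. -/
noncomputable def classIndicator {M : ℕ} (a : ZMod M) (n : ℕ) : ℝ :=
  if 1 < n ∧ SquarefreeAway M n ∧ (n : ZMod M) = a then 1 else 0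

lemma abs_classIndicator_le_one {M : ℕ} (a : ZMod M) (n : ℕ) : |classIndicator a n| ≤ 1 := by
  unfold classIndicator
  split_ifs <;> simp

lemma hasMean_classIndicator {M : ℕ} (hM : 0 < M) (a : ZMod M) :
    HasMean (classIndicator a) (squarefreeConst M / M) := by
  refine (hasMean_squarefreeAway hM a).congr_of_one_lt fun n hn => ?_
  classical
  exact if_congr (and_iff_right hn) rfl rfl

open scoped Classical in
lemma sum_classIndicator_mul {M : ℕ} (R : Finset (ZMod M × ZMod M)) (m k : ℕ) :
    ∑ ab ∈ R, classIndicator ab.1 m * classIndicator ab.2 k =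
      if 1 < m ∧ SquarefreeAway M m ∧ 1 < k ∧ SquarefreeAway M k ∧
        ((m : ZMod M), (k : ZMod M)) ∈ R then 1 else 0 := by
  by_cases h : 1 < m ∧ SquarefreeAway M m ∧ 1 < k ∧ SquarefreeAway M k
  · obtain ⟨h1, h2, h3, h4⟩ := h
    simp only [classIndicator, h1, h2, h3, h4, true_and, mul_ite, mul_one, mul_zero]
    rw [← Finset.sum_ite_eq R ((m : ZMod M), (k : ZMod M)) fun _ => (1 : ℝ)]
    refine Finset.sum_congr rfl fun ab _ => ?_
    rw [← ite_and]
    refine if_congr ?_ rfl rfl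
    rw [Prod.ext_iff, and_comm]
  · rw [if_neg (by tauto)]
    refine Finset.sum_eq_zero fun ab _ => ?_
    unfold classIndicator
    split_ifs <;> first | tauto | simp

open scoped Classical in
lemma sum_boole_mul_le (N : ℕ) (f g : ℕ → ℝ) :
    ∑ mk ∈ Finset.Ioc 0 N ×ˢ Finset.Ioc 0 N, (if mk.1 * mk.2 ≤ N then f mk.1 * g mk.2 else 0) =
      ∑ a ∈ Finset.Ioc 0 N, f a * ∑ b ∈ Finset.Ioc 0 (N / a), g b := by
  rw [Finset.sum_product]
  refine Finset.sum_congr rfl fun a ha => ?_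
  rw [Finset.mem_Ioc] at ha
  rw [← Finset.sum_filter, Finset.mul_sum]
  refine Finset.sum_congr ?_ fun _ _ => rfl
  ext b
  simp only [Finset.mem_filter, Finset.mem_Ioc, Nat.le_div_iff_mul_le ha.1]
  constructor
  · rintro ⟨⟨h1, -⟩, h2⟩
    exact ⟨h1, by rwa [mul_comm]⟩
  · rintro ⟨h1, h2⟩
    refine ⟨⟨h1, ?_⟩, by rwa [mul_comm]⟩
    exact (Nat.le_mul_of_pos_right b ha.1).trans h2

open scoped Classical in
lemma tendsto_card_pairs {M : ℕ} (hM : 0 < M) (R : Finset (ZMod M × ZMod M)) :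
    Tendsto (fun N : ℕ => (((Finset.Ioc 0 N ×ˢ Finset.Ioc 0 N).filter fun mk : ℕ × ℕ =>
        mk.1 * mk.2 ≤ N ∧ 1 < mk.1 ∧ SquarefreeAway M mk.1 ∧ 1 < mk.2 ∧ SquarefreeAway M mk.2 ∧
          ((mk.1 : ZMod M), (mk.2 : ZMod M)) ∈ R).card : ℝ) / (N * harmonicSum N))
      atTop (𝓝 (R.card * (squarefreeConst M / M) ^ 2)) := by
  have h := tendsto_finsetSum R fun ab _ =>
    HasMean.tendsto_sum_mul (abs_classIndicator_le_one ab.1) (hasMean_classIndicator hM ab.1)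
      (hasMean_classIndicator hM ab.2)
  rw [Finset.sum_const, nsmul_eq_mul, ← sq] at h
  refine h.congr fun N => ?_
  rw [← Finset.sum_div]
  congr 1
  simp only [← sum_boole_mul_le]
  rw [Finset.sum_comm, ← Finset.sum_boole]
  refine Finset.sum_congr rfl fun mk _ => ?_
  rw [ite_and, ← sum_classIndicator_mul]
  split_ifs <;> simp

open scoped Classical in
lemma ncard_pairs_eq (P : ℤ → ℤ → Prop) (hP : ∀ a b, P a b → 1 < a ∧ 1 < b) (x : ℝ) :
    {DD : ℤ × ℤ | P DD.1 DD.2 ∧ ((DD.1 * DD.2 : ℤ) : ℝ) ≤ x}.ncard =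
      ((Finset.Ioc 0 ⌊x⌋₊ ×ˢ Finset.Ioc 0 ⌊x⌋₊).filter fun mk : ℕ × ℕ =>
        mk.1 * mk.2 ≤ ⌊x⌋₊ ∧ P mk.1 mk.2).card := by
  have hinj : Function.Injective (Prod.map Nat.cast Nat.cast : ℕ × ℕ → ℤ × ℤ) :=
    Nat.cast_injective.prodMap Nat.cast_injective
  rw [← Set.ncard_coe_finset, ← Set.ncard_image_of_injective _ hinj]
  congr 1
  ext ⟨a, b⟩
  simp only [Set.mem_ofPred_eq, Set.mem_image, Finset.coe_filter, Finset.mem_product,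
    Finset.mem_Ioc, Prod.exists, Prod.map_apply, Prod.mk.injEq]
  constructor
  · rintro ⟨hab, hx⟩
    obtain ⟨ha, hb⟩ := hP a b hab
    lift a to ℕ using by omega
    lift b to ℕ using by omega
    have hle : a * b ≤ ⌊x⌋₊ := Nat.le_floor (by exact_mod_cast hx)
    have ha' : 0 < a := by omega
    have hb' : 0 < b := by omega
    exact ⟨a, b, ⟨⟨⟨ha', (Nat.le_mul_of_pos_right a hb').trans hle⟩, hb',
      (Nat.le_mul_of_pos_left b ha').trans hle⟩, hle, hab⟩, rfl, rfl⟩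
  · rintro ⟨m, k, ⟨⟨⟨hm, -⟩, hk, -⟩, hle, h⟩, rfl, rfl⟩
    refine ⟨h, ?_⟩
    have := (Nat.le_floor_iff' (Nat.mul_pos hm hk).ne').1 hle
    exact_mod_cast this

lemma tendsto_ncard_pairs {M : ℕ} (hM : 0 < M) (R : Finset (ZMod M × ZMod M)) (P : ℤ → ℤ → Prop)
    (hP : ∀ a b, P a b → 1 < a ∧ 1 < b)
    (hR : ∀ m k : ℕ, P m k ↔ 1 < m ∧ SquarefreeAway M m ∧ 1 < k ∧ SquarefreeAway M k ∧
      ((m : ZMod M), (k : ZMod M)) ∈ R) :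
    Tendsto (fun x : ℝ => ({DD : ℤ × ℤ | P DD.1 DD.2 ∧ ((DD.1 * DD.2 : ℤ) : ℝ) ≤ x}.ncard : ℝ) /
        (⌊x⌋₊ * harmonicSum ⌊x⌋₊))
      atTop (𝓝 (R.card * (squarefreeConst M / M) ^ 2)) := by
  refine ((tendsto_card_pairs hM R).comp tendsto_nat_floor_atTop).congr fun x => ?_
  rw [ncard_pairs_eq P hP x]
  simp only [Function.comp]
  congr 3
  classical
  exact Finset.filter_congr fun mk _ => and_congr_right fun _ => (hR mk.1 mk.2).symm

lemma tendsto_ncard_pairs_div {M : ℕ} (hM : 0 < M) (R S : Finset (ZMod M × ZMod M))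
    (hS : S.Nonempty) (P Q : ℤ → ℤ → Prop)
    (hP : ∀ a b, P a b → 1 < a ∧ 1 < b) (hQ : ∀ a b, Q a b → 1 < a ∧ 1 < b)
    (hR : ∀ m k : ℕ, P m k ↔ 1 < m ∧ SquarefreeAway M m ∧ 1 < k ∧ SquarefreeAway M k ∧
      ((m : ZMod M), (k : ZMod M)) ∈ R)
    (hS' : ∀ m k : ℕ, Q m k ↔ 1 < m ∧ SquarefreeAway M m ∧ 1 < k ∧ SquarefreeAway M k ∧
      ((m : ZMod M), (k : ZMod M)) ∈ S) :
    Tendsto (fun x : ℝ => ({DD : ℤ × ℤ | P DD.1 DD.2 ∧ ((DD.1 * DD.2 : ℤ) : ℝ) ≤ x}.ncard : ℝ) /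
        ({DD : ℤ × ℤ | Q DD.1 DD.2 ∧ ((DD.1 * DD.2 : ℤ) : ℝ) ≤ x}.ncard : ℝ))
      atTop (𝓝 ((R.card : ℝ) / S.card)) := by
  have hc : 0 < squarefreeConst M / M := div_pos (squarefreeConst_pos M) (by exact_mod_cast hM)
  have hS0 : (0 : ℝ) < S.card := by exact_mod_cast hS.card_pos
  have h := (tendsto_ncard_pairs hM R P hP hR).div (tendsto_ncard_pairs hM S Q hQ hS')
    (by positivity)
  rw [mul_div_mul_right _ _ (by positivity)] at h
  refine h.congr' ?_
  filter_upwards [tendsto_nat_floor_atTop.eventually (tendsto_harmonicSum.eventually_gt_atTop 0),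
    (tendsto_nat_floor_atTop (α := ℝ)).eventually_gt_atTop 0] with x hx1 hx2
  have hx3 : (0 : ℝ) < ⌊x⌋₊ := by exact_mod_cast hx2
  exact div_div_div_cancel_right₀ (by positivity) _ _

lemma card_filter_forall_crt {ι : Type*} [Fintype ι] (q : ι → ℕ) [∀ i, NeZero (q i)]
    [NeZero (∏ i, q i)] (hq : Pairwise (Function.onFun Nat.Coprime q)) (L : ι → ℕ → ℕ → Prop)
    [∀ i, DecidableRel (L i)] (hL : ∀ i m k, L i (m % q i) (k % q i) ↔ L i m k) :
    (Finset.univ.filter fun ab : ZMod (∏ i, q i) × ZMod (∏ i, q i) =>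
        ∀ i, L i ab.1.val ab.2.val).card =
      ∏ i, ((Finset.range (q i) ×ˢ Finset.range (q i)).filter fun uv => L i uv.1 uv.2).card := by
  classical
  rw [← Fintype.card_piFinset]
  have hval : ∀ (a : ZMod (∏ i, q i)) (i : ι), (ZMod.prodEquivPi q hq a i).val = a.val % q i := by
    intro a i
    conv_lhs => rw [← ZMod.natCast_zmod_val a, map_natCast, Pi.natCast_apply, ZMod.val_natCast]
  refine Finset.card_bij (fun ab _ i => (ab.1.val % q i, ab.2.val % q i)) ?_ ?_ ?_
  · intro ab hab
    simp only [Finset.mem_filter, Finset.mem_univ, true_and] at hab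
    simp only [Fintype.mem_piFinset, Finset.mem_filter, Finset.mem_product, Finset.mem_range, hL]
    exact fun i => ⟨⟨Nat.mod_lt _ (NeZero.pos _), Nat.mod_lt _ (NeZero.pos _)⟩, hab i⟩
  · intro ab _ cd _ h
    have h1 : ∀ i, ab.1.val % q i = cd.1.val % q i ∧ ab.2.val % q i = cd.2.val % q i :=
      fun i => Prod.ext_iff.1 (congrFun h i)
    refine Prod.ext ((ZMod.prodEquivPi q hq).injective (funext fun i => ZMod.val_injective _ ?_))
      ((ZMod.prodEquivPi q hq).injective (funext fun i => ZMod.val_injective _ ?_))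
    · rw [hval, hval, (h1 i).1]
    · rw [hval, hval, (h1 i).2]
  · intro w hw
    simp only [Fintype.mem_piFinset, Finset.mem_filter, Finset.mem_product, Finset.mem_range] at hw
    have hinv : ∀ (v : ∀ i, ℕ) (i : ι), v i < q i →
        ((ZMod.prodEquivPi q hq).symm fun i => (v i : ZMod (q i))).val % q i = v i := by
      intro v i hi
      rw [← hval, RingEquiv.apply_symm_apply, ZMod.val_natCast, Nat.mod_eq_of_lt hi]
    have h1 := fun i => hinv (fun i => (w i).1) i (hw i).1.1
    have h2 := fun i => hinv (fun i => (w i).2) i (hw i).1.2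
    refine ⟨((ZMod.prodEquivPi q hq).symm fun i => ((w i).1 : ZMod (q i)),
      (ZMod.prodEquivPi q hq).symm fun i => ((w i).2 : ZMod (q i))), ?_, ?_⟩
    · simp only [Finset.mem_filter, Finset.mem_univ, true_and]
      intro i
      rw [← hL, h1, h2]
      exact (hw i).2
    · funext i
      exact Prod.ext (h1 i) (h2 i)

/-- The residues modulo `p ^ 2` not divisible by `p ^ 2` with Jacobi symbol `e` at `p`. -/
def symbolClass (p : ℕ) (e : ℤ) : Finset ℕ :=
  (Finset.range (p ^ 2)).filter fun u => ¬ p ^ 2 ∣ u ∧ jacobiSym u p = e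

lemma jacobiSym_natCast_eq_zero_iff {p : ℕ} (hp : p.Prime) (u : ℕ) :
    jacobiSym u p = 0 ↔ p ∣ u := by
  have := Fact.mk hp
  rw [← jacobiSym.legendreSym.to_jacobiSym, legendreSym.eq_zero_iff]
  simp [ZMod.natCast_eq_zero_iff]

lemma jacobiSym_natCast_mod {p : ℕ} (u : ℕ) {q : ℕ} (h : p ∣ q) :
    jacobiSym ((u % q : ℕ) : ℤ) p = jacobiSym u p := by
  rw [jacobiSym.mod_left, jacobiSym.mod_left (u : ℤ)]
  congr 1
  norm_cast
  exact Nat.mod_mod_of_dvd u h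

lemma sum_range_jacobiSym {p : ℕ} (hp : p.Prime) (h2 : p ≠ 2) :
    ∑ u ∈ Finset.range p, jacobiSym (u : ℤ) p = 0 := by
  have := Fact.mk hp
  have h := quadraticChar_sum_zero (F := ZMod p) (by rwa [ZMod.ringChar_zmod_n])
  rw [← h]
  refine Finset.sum_bij (fun u _ => (u : ZMod p)) (fun _ _ => Finset.mem_univ _) ?_ ?_ ?_
  · intro a ha b hb hab
    rw [Finset.mem_range] at ha hb
    have := (ZMod.natCast_eq_natCast_iff _ _ _).1 hab
    exact Nat.ModEq.eq_of_lt_of_lt this ha hb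
  · intro b _
    exact ⟨b.val, Finset.mem_range.2 (ZMod.val_lt b), ZMod.natCast_zmod_val b⟩
  · intro a _
    rw [← jacobiSym.legendreSym.to_jacobiSym, legendreSym]
    simp

lemma sum_range_mul_jacobiSym {p : ℕ} (hp : p.Prime) (h2 : p ≠ 2) (k : ℕ) :
    ∑ u ∈ Finset.range (k * p), jacobiSym (u : ℤ) p = 0 := by
  induction k with
  | zero => simp
  | succ k ih =>
    rw [add_mul, one_mul, Finset.sum_range_add, ih, zero_add, ← sum_range_jacobiSym hp h2]
    refine Finset.sum_congr rfl fun u _ => ?_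
    rw [← jacobiSym_natCast_mod _ dvd_rfl, Nat.mul_add_mod_self_right,
      jacobiSym_natCast_mod _ dvd_rfl]

lemma card_symbolClass_zero {p : ℕ} (hp : p.Prime) : (symbolClass p 0).card + 1 = p := by
  have h : symbolClass p 0 = (Finset.Ioc 0 (p ^ 2 - 1)).filter fun u => p ∣ u := by
    ext u
    simp only [symbolClass, Finset.mem_filter, Finset.mem_range, Finset.mem_Ioc,
      jacobiSym_natCast_eq_zero_iff hp]
    constructor
    · rintro ⟨h1, h2, h3⟩
      refine ⟨⟨Nat.pos_of_ne_zero ?_, by omega⟩, h3⟩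
      rintro rfl
      exact h2 (dvd_zero _)
    · rintro ⟨⟨h1, h2⟩, h3⟩
      exact ⟨by omega, fun h => by have := Nat.le_of_dvd h1 h; omega, h3⟩
  rw [h, Nat.Ioc_filter_dvd_card_eq_div]
  have h1 := hp.two_le
  obtain ⟨k, rfl⟩ : ∃ k, p = k + 1 := ⟨p - 1, by omega⟩
  have : (k + 1) ^ 2 - 1 = (k + 1) * k + k := by
    rw [Nat.sub_eq_iff_eq_add (by nlinarith)]; ring
  rw [this, Nat.mul_add_div (by omega), Nat.div_eq_of_lt (by omega)]

lemma card_range_sq_not_dvd {p : ℕ} (hp : p.Prime) :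
    ((Finset.range (p ^ 2)).filter fun u => ¬ p ^ 2 ∣ u).card + 1 = p ^ 2 := by
  have hpos : 0 < p ^ 2 := pow_pos hp.pos 2
  have h : (Finset.range (p ^ 2)).filter (fun u => ¬ p ^ 2 ∣ u) =
      (Finset.range (p ^ 2)).erase 0 := by
    ext u
    simp only [Finset.mem_filter, Finset.mem_erase, Finset.mem_range, and_comm (a := u < _)]
    refine and_congr_left fun hu => not_congr ⟨fun hd => Nat.eq_zero_of_dvd_of_lt hd hu, ?_⟩
    rintro rfl
    exact dvd_zero _
  rw [h, Finset.card_erase_add_one (Finset.mem_range.2 hpos), Finset.card_range]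

lemma not_sq_dvd_of_jacobiSym_ne_zero {p : ℕ} (hp : p.Prime) {u : ℕ} (h : jacobiSym u p ≠ 0) :
    ¬ p ^ 2 ∣ u := fun hd =>
  h ((jacobiSym_natCast_eq_zero_iff hp u).2 ((dvd_pow_self p two_ne_zero).trans hd))

lemma card_symbolClass_sum {p : ℕ} (hp : p.Prime) :
    (symbolClass p 0).card + (symbolClass p 1).card + (symbolClass p (-1)).card + 1 = p ^ 2 := by
  rw [← card_range_sq_not_dvd hp]
  congr 1
  have h := Finset.card_eq_sum_card_fiberwise (f := fun u : ℕ => jacobiSym u p)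
    (s := (Finset.range (p ^ 2)).filter fun u => ¬ p ^ 2 ∣ u) (t := {0, 1, -1}) fun u _ => by
      simpa using jacobiSym.trichotomy u p
  rw [h, Finset.sum_insert (by simp), Finset.sum_insert (by simp), Finset.sum_singleton,
    ← add_assoc]
  simp only [Finset.filter_filter]
  rfl

lemma card_symbolClass_one_eq {p : ℕ} (hp : p.Prime) (h2 : p ≠ 2) :
    (symbolClass p 1).card = (symbolClass p (-1)).card := by
  have h := sum_range_mul_jacobiSym hp h2 p
  rw [← sq] at h
  have h1 : ∀ e : ℤ, e ≠ 0 → symbolClass p e =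
      (Finset.range (p ^ 2)).filter fun u : ℕ => jacobiSym (u : ℤ) p = e := by
    intro e he
    refine Finset.filter_congr fun u _ => ?_
    exact and_iff_right_of_imp fun h => not_sq_dvd_of_jacobiSym_ne_zero hp (h ▸ he)
  rw [h1 1 (by simp), h1 (-1) (by simp)]
  zify
  rw [← sub_eq_zero, ← h, ← Finset.sum_boole, ← Finset.sum_boole, ← Finset.sum_sub_distrib]
  refine Finset.sum_congr rfl fun u _ => ?_
  rcases jacobiSym.trichotomy u p with h | h | h <;> simp [h]

lemma two_mul_card_symbolClass {p : ℕ} (hp : p.Prime) (h2 : p ≠ 2) {e : ℤ} (he : e = -1 ∨ e = 1) :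
    2 * (symbolClass p e).card + p = p ^ 2 := by
  have h3 := card_symbolClass_zero hp
  have h4 := card_symbolClass_sum hp
  have h5 := card_symbolClass_one_eq hp h2
  rcases he with rfl | rfl <;> omega

/-- The moduli `16` and `pᵢ ^ 2`. -/
def localModulus {ℓ : ℕ} (p : Fin ℓ → ℕ) : Option (Fin ℓ) → ℕ
  | none => 16
  | some i => p i ^ 2

/-- The residues modulo `16` of discriminants which are fundamental at `2`. -/
def FundamentalAtTwo (n : ℕ) : Prop :=
  n % 4 = 1 ∨ n % 16 = 8 ∨ n % 16 = 12

instance : DecidablePred FundamentalAtTwo := fun n =>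
  inferInstanceAs (Decidable (n % 4 = 1 ∨ n % 16 = 8 ∨ n % 16 = 12))

/-- Both entries of a pair are fundamental at `2`, respectively at `pᵢ`. -/
def LocalFundamental {ℓ : ℕ} (p : Fin ℓ → ℕ) : Option (Fin ℓ) → ℕ → ℕ → Prop
  | none, m, k => FundamentalAtTwo m ∧ FundamentalAtTwo k
  | some i, m, k => ¬ p i ^ 2 ∣ m ∧ ¬ p i ^ 2 ∣ k

/-- The sign attached to `(m, k)` at `q` equals `e`. -/
def SignEq (q : ℕ) (e : ℤ) (m k : ℕ) : Prop :=
  (jacobiSym k q ≠ 0 → jacobiSym k q = e) ∧ (jacobiSym k q = 0 → jacobiSym m q = e)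

/-- No condition at `2`, and the sign condition at `pᵢ`. -/
def LocalSign {ℓ : ℕ} (p : Fin ℓ → ℕ) (ε : Fin ℓ → ℤ) : Option (Fin ℓ) → ℕ → ℕ → Prop
  | none, _, _ => True
  | some i, m, k => SignEq (p i) (ε i) m k

lemma localFundamental_mod {ℓ : ℕ} (p : Fin ℓ → ℕ) (o : Option (Fin ℓ)) (m k : ℕ) :
    LocalFundamental p o (m % localModulus p o) (k % localModulus p o) ↔
      LocalFundamental p o m k := by
  cases o with
  | none =>
    simp only [LocalFundamental, localModulus, FundamentalAtTwo]
    omega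
  | some i => simp only [LocalFundamental, localModulus, Nat.dvd_mod_iff dvd_rfl]

lemma localSign_mod {ℓ : ℕ} (p : Fin ℓ → ℕ) (ε : Fin ℓ → ℤ) (o : Option (Fin ℓ)) (m k : ℕ) :
    LocalSign p ε o (m % localModulus p o) (k % localModulus p o) ↔ LocalSign p ε o m k := by
  cases o with
  | none => rfl
  | some i =>
    simp only [LocalSign, localModulus, SignEq,
      jacobiSym_natCast_mod _ (dvd_pow_self (p i) two_ne_zero)]

lemma pairwise_coprime_localModulus {ℓ : ℕ} {p : Fin ℓ → ℕ} (hp : ∀ i, (p i).Prime)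
    (hodd : ∀ i, p i ≠ 2) (hdist : Function.Injective p) :
    Pairwise (Function.onFun Nat.Coprime (localModulus p)) := by
  have h2 : ∀ i, Nat.Coprime 16 (p i ^ 2) := fun i =>
    Nat.Coprime.pow 4 2 ((Nat.coprime_primes Nat.prime_two (hp i)).2 (hodd i).symm)
  intro a b hab
  cases a with
  | none =>
    cases b with
    | none => exact absurd rfl hab
    | some j => exact h2 j
  | some i =>
    cases b with
    | none => exact (h2 i).symm
    | some j =>
      exact Nat.Coprime.pow 2 2 ((Nat.coprime_primes (hp i) (hp j)).2 fun h =>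
        hab (congrArg some (hdist h)))

lemma coprime_prod_localModulus_iff {ℓ : ℕ} {p : Fin ℓ → ℕ} (hp : ∀ i, (p i).Prime) {q : ℕ}
    (hq : q.Prime) : q.Coprime (∏ o, localModulus p o) ↔ q ≠ 2 ∧ ∀ i, q ≠ p i := by
  have h16 : (16 : ℕ) = 2 ^ 4 := by norm_num
  rw [Nat.coprime_prod_right_iff]
  simp only [Finset.mem_univ, true_imp_iff, Option.forall, localModulus, h16]
  rw [Nat.coprime_pow_right_iff (by norm_num), Nat.coprime_primes hq Nat.prime_two]
  refine and_congr_right fun _ => forall_congr' fun i => ?_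
  rw [Nat.coprime_pow_right_iff (by norm_num), Nat.coprime_primes hq (hp i)]

lemma isFundamentalDiscriminant_natCast_iff_s5 {n : ℕ} (hn : 1 < n) :
    IsFundamentalDiscriminant n ↔
      FundamentalAtTwo n ∧ ∀ q : ℕ, q.Prime → q ≠ 2 → ¬ q ^ 2 ∣ n := by
  have hodd : ∀ q : ℕ, q.Prime → q ≠ 2 → (q ^ 2).Coprime 4 := fun q hq h2 =>
    Nat.Coprime.pow 2 2 ((Nat.coprime_primes hq Nat.prime_two).2 h2)
  unfold IsFundamentalDiscriminant FundamentalAtTwo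
  have h4 : (n : ℤ) / 4 = ((n / 4 : ℕ) : ℤ) := by simp
  rw [h4, Int.squarefree_natCast, Int.squarefree_natCast, Nat.squarefree_iff_prime_squarefree,
    Nat.squarefree_iff_prime_squarefree]
  simp only [← sq]
  constructor
  · rintro ⟨-, ⟨h1, h2⟩ | ⟨h1, h2, h3⟩⟩
    · exact ⟨by omega, fun q hq _ => h2 q hq⟩
    · refine ⟨by omega, fun q hq hq2 hd => h2 q hq ?_⟩
      have h5 : n = 4 * (n / 4) := by omega
      rw [h5] at hd
      exact (hodd q hq hq2).dvd_of_dvd_mul_left hd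
  · rintro ⟨h1, h2⟩
    refine ⟨by omega, ?_⟩
    rcases h1 with h1 | h1
    · refine Or.inl ⟨by omega, fun q hq hd => ?_⟩
      by_cases hq2 : q = 2
      · subst hq2
        omega
      · exact h2 q hq hq2 hd
    · refine Or.inr ⟨by omega, fun q hq hd => ?_, by omega⟩
      by_cases hq2 : q = 2
      · subst hq2
        omega
      · exact h2 q hq hq2 (hd.trans (Nat.div_dvd_of_dvd (by omega)))

lemma squarefreeAway_iff {M n : ℕ} :
    SquarefreeAway M n ↔ ∀ q : ℕ, q.Prime → q.Coprime M → ¬ q ^ 2 ∣ n := by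
  constructor
  · intro h q hq hc hd
    exact hq.one_lt.ne' (h q hc hd)
  · intro h d hc hd
    by_contra h1
    obtain ⟨q, hq, hqd⟩ := Nat.exists_prime_and_dvd h1
    exact h q hq (hc.coprime_dvd_left hqd) ((pow_dvd_pow_of_dvd hqd 2).trans hd)

lemma isFundamentalDiscriminant_iff_local {ℓ : ℕ} {p : Fin ℓ → ℕ} (hp : ∀ i, (p i).Prime)
    (hodd : ∀ i, p i ≠ 2) {n : ℕ} (hn : 1 < n) :
    IsFundamentalDiscriminant n ↔ SquarefreeAway (∏ o, localModulus p o) n ∧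
      FundamentalAtTwo n ∧ ∀ i, ¬ p i ^ 2 ∣ n := by
  rw [isFundamentalDiscriminant_natCast_iff_s5 hn, squarefreeAway_iff]
  constructor
  · rintro ⟨h1, h2⟩
    refine ⟨fun q hq hc => h2 q hq ?_, h1, fun i => h2 _ (hp i) (hodd i)⟩
    exact ((coprime_prod_localModulus_iff hp hq).1 hc).1
  · rintro ⟨h1, h2, h3⟩
    refine ⟨h2, fun q hq hq2 => ?_⟩
    by_cases h : ∃ i, q = p i
    · obtain ⟨i, rfl⟩ := h
      exact h3 i
    · exact h1 q hq ((coprime_prod_localModulus_iff hp hq).2 ⟨hq2, not_exists.1 h⟩)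

lemma pair_isFundamentalDiscriminant_iff {ℓ : ℕ} {p : Fin ℓ → ℕ} (hp : ∀ i, (p i).Prime)
    (hodd : ∀ i, p i ≠ 2) (m k : ℕ) :
    (IsFundamentalDiscriminant m ∧ IsFundamentalDiscriminant k ∧ (1 : ℤ) < m ∧ (1 : ℤ) < k) ↔
      1 < m ∧ SquarefreeAway (∏ o, localModulus p o) m ∧ 1 < k ∧
        SquarefreeAway (∏ o, localModulus p o) k ∧ ∀ o, LocalFundamental p o m k := by
  simp only [Option.forall, LocalFundamental, forall_and, Nat.one_lt_cast]
  by_cases hm : 1 < m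
  · by_cases hk : 1 < k
    · rw [isFundamentalDiscriminant_iff_local hp hodd hm,
        isFundamentalDiscriminant_iff_local hp hodd hk]
      tauto
    · tauto
  · tauto

lemma mem_filter_forall_val_iff {ι : Type*} [Fintype ι] (q : ι → ℕ) [NeZero (∏ i, q i)]
    (L : ι → ℕ → ℕ → Prop) [∀ i, DecidableRel (L i)]
    (hL : ∀ i m k, L i (m % q i) (k % q i) ↔ L i m k) (m k : ℕ) :
    (((m : ZMod (∏ i, q i)), (k : ZMod (∏ i, q i))) ∈ Finset.univ.filter
      fun ab : ZMod (∏ i, q i) × ZMod (∏ i, q i) => ∀ i, L i ab.1.val ab.2.val) ↔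
      ∀ i, L i m k := by
  simp only [Finset.mem_filter, Finset.mem_univ, true_and, ZMod.val_natCast]
  refine forall_congr' fun i => ?_
  rw [← hL, Nat.mod_mod_of_dvd _ (Finset.dvd_prod_of_mem q (Finset.mem_univ i)),
    Nat.mod_mod_of_dvd _ (Finset.dvd_prod_of_mem q (Finset.mem_univ i)), hL]

open scoped Classical in
lemma card_localFundamental_some {q : ℕ} (hq : q.Prime) :
    (((Finset.range (q ^ 2) ×ˢ Finset.range (q ^ 2)).filter fun uv =>
      ¬ q ^ 2 ∣ uv.1 ∧ ¬ q ^ 2 ∣ uv.2).card : ℝ) = ((q : ℝ) ^ 2 - 1) ^ 2 := by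
  have h : (((Finset.range (q ^ 2)).filter fun u => ¬ q ^ 2 ∣ u).card : ℝ) + 1 = (q : ℝ) ^ 2 := by
    exact_mod_cast card_range_sq_not_dvd hq
  rw [Finset.filter_product (fun u => ¬ q ^ 2 ∣ u) (fun u => ¬ q ^ 2 ∣ u), Finset.card_product,
    Nat.cast_mul, ← h]
  ring

open scoped Classical in
lemma card_localSign_some {q : ℕ} (hq : q.Prime) (h2 : q ≠ 2) {e : ℤ}
    (he : e = -1 ∨ e = 0 ∨ e = 1) :
    (((Finset.range (q ^ 2) ×ˢ Finset.range (q ^ 2)).filter fun uv =>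
      (¬ q ^ 2 ∣ uv.1 ∧ ¬ q ^ 2 ∣ uv.2) ∧ SignEq q e uv.1 uv.2).card : ℝ) =
      (if e = 0 then 1 / ((q : ℝ) + 1) ^ 2
        else (q : ℝ) * ((q : ℝ) + 2) / (2 * ((q : ℝ) + 1) ^ 2)) * ((q : ℝ) ^ 2 - 1) ^ 2 := by
  have hq0 : (0 : ℝ) < q := by exact_mod_cast hq.pos
  have h0 : ((symbolClass q 0).card : ℝ) = q - 1 := by
    rw [eq_sub_iff_add_eq]
    exact_mod_cast card_symbolClass_zero hq
  split_ifs with h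
  · subst h
    have hs : (Finset.range (q ^ 2) ×ˢ Finset.range (q ^ 2)).filter (fun uv =>
        (¬ q ^ 2 ∣ uv.1 ∧ ¬ q ^ 2 ∣ uv.2) ∧ SignEq q 0 uv.1 uv.2) =
        symbolClass q 0 ×ˢ symbolClass q 0 := by
      ext ⟨u, v⟩
      rw [Finset.mem_filter, Finset.mem_product, Finset.mem_product, symbolClass,
        Finset.mem_filter, Finset.mem_filter, SignEq]
      tauto
    rw [hs, Finset.card_product, Nat.cast_mul, h0]
    field_simp
    ring
  · have he' : e = -1 ∨ e = 1 := by tauto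
    have hs : (Finset.range (q ^ 2) ×ˢ Finset.range (q ^ 2)).filter (fun uv =>
        (¬ q ^ 2 ∣ uv.1 ∧ ¬ q ^ 2 ∣ uv.2) ∧ SignEq q e uv.1 uv.2) =
        ((Finset.range (q ^ 2)).filter fun u => ¬ q ^ 2 ∣ u) ×ˢ symbolClass q e ∪
          symbolClass q e ×ˢ symbolClass q 0 := by
      ext ⟨u, v⟩
      rw [Finset.mem_filter, Finset.mem_union, Finset.mem_product, Finset.mem_product,
        Finset.mem_product, symbolClass, symbolClass, Finset.mem_filter, Finset.mem_filter,
        Finset.mem_filter, Finset.mem_filter, SignEq]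
      by_cases hv : jacobiSym v q = 0
      · have h' : ¬ (0 : ℤ) = e := fun h' => h h'.symm
        simp only [hv, h', ne_eq, not_true_eq_false, false_imp_iff, true_imp_iff, true_and,
          and_false, false_or, and_true]
        tauto
      · simp only [hv, ne_eq, not_false_eq_true, true_imp_iff, false_imp_iff, and_true,
          and_false, or_false]
        tauto
    have hd : Disjoint (((Finset.range (q ^ 2)).filter fun u => ¬ q ^ 2 ∣ u) ×ˢ symbolClass q e)
        (symbolClass q e ×ˢ symbolClass q 0) := by
      rw [Finset.disjoint_left]
      rintro ⟨u, v⟩ h1 h3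
      simp only [symbolClass, Finset.mem_filter, Finset.mem_product] at h1 h3
      exact h (h1.2.2.2.symm.trans h3.2.2.2)
    have h3 : (((Finset.range (q ^ 2)).filter fun u => ¬ q ^ 2 ∣ u).card : ℝ) =
        (q : ℝ) ^ 2 - 1 := by
      rw [eq_sub_iff_add_eq]
      exact_mod_cast card_range_sq_not_dvd hq
    have h4 : 2 * ((symbolClass q e).card : ℝ) + q = (q : ℝ) ^ 2 := by
      exact_mod_cast two_mul_card_symbolClass hq h2 he'
    have h5 : ((symbolClass q e).card : ℝ) = ((q : ℝ) ^ 2 - q) / 2 := by linarith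
    rw [hs, Finset.card_union_of_disjoint hd, Finset.card_product, Finset.card_product]
    push_cast
    rw [h0, h3, h5]
    field_simp
    ring

/-- Given distinct odd primes `p₁, …, p_ℓ` and signs `ε₁, …, ε_ℓ ∈ {-1,0,1}`, the proportion
of pairs `(D₁, D₂)` of fundamental discriminants `> 1` with `D₁D₂ ≤ x` such that for each `i`
the sign of the `pᵢ`-th Fourier coefficient (namely `(D₂|pᵢ)` if this is nonzero, and
`(D₁|pᵢ)` otherwise) equals `εᵢ`, converges to
`(∏_{εᵢ=0} 1/(pᵢ+1)²)·(∏_{εᵢ≠0} pᵢ(pᵢ+2)/(2(pᵢ+1)²))`. -/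
theorem stmt_5 (ℓ : ℕ) (p : Fin ℓ → ℕ) (hp : ∀ i, (p i).Prime) (hodd : ∀ i, p i ≠ 2)
    (hdist : Function.Injective p) (ε : Fin ℓ → ℤ)
    (hε : ∀ i, ε i = -1 ∨ ε i = 0 ∨ ε i = 1) :
    Tendsto (fun x : ℝ =>
        ({DD : ℤ × ℤ | IsFundamentalDiscriminant DD.1 ∧ IsFundamentalDiscriminant DD.2 ∧
            1 < DD.1 ∧ 1 < DD.2 ∧ ((DD.1 * DD.2 : ℤ) : ℝ) ≤ x ∧
            ∀ i, (jacobiSym DD.2 (p i) ≠ 0 → jacobiSym DD.2 (p i) = ε i) ∧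
                 (jacobiSym DD.2 (p i) = 0 → jacobiSym DD.1 (p i) = ε i)}.ncard : ℝ) /
        ({DD : ℤ × ℤ | IsFundamentalDiscriminant DD.1 ∧ IsFundamentalDiscriminant DD.2 ∧
            1 < DD.1 ∧ 1 < DD.2 ∧ ((DD.1 * DD.2 : ℤ) : ℝ) ≤ x}.ncard : ℝ))
      atTop
      (nhds ((∏ i ∈ Finset.univ.filter (fun i => ε i = 0), 1 / ((p i : ℝ) + 1) ^ 2) *
             (∏ i ∈ Finset.univ.filter (fun i => ε i ≠ 0),
                (p i : ℝ) * ((p i : ℝ) + 2) / (2 * ((p i : ℝ) + 1) ^ 2)))) := by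
  classical
  have hpos : ∀ o, 0 < localModulus p o := by
    rintro (_ | i)
    · exact Nat.succ_pos _
    · exact pow_pos (hp i).pos 2
  have hM : 0 < ∏ o, localModulus p o := Finset.prod_pos fun o _ => hpos o
  have : ∀ o, NeZero (localModulus p o) := fun o => ⟨(hpos o).ne'⟩
  have : NeZero (∏ o, localModulus p o) := ⟨hM.ne'⟩
  have hcop := pairwise_coprime_localModulus hp hodd hdist
  have hLF := localFundamental_mod p
  have hLA : ∀ o m k, (LocalFundamental p o (m % localModulus p o) (k % localModulus p o) ∧
      LocalSign p ε o (m % localModulus p o) (k % localModulus p o)) ↔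
      (LocalFundamental p o m k ∧ LocalSign p ε o m k) := fun o m k =>
    and_congr (hLF o m k) (localSign_mod p ε o m k)
  have hcF := card_filter_forall_crt (localModulus p) hcop (LocalFundamental p) hLF
  have hcA := card_filter_forall_crt (localModulus p) hcop
    (fun o m k => LocalFundamental p o m k ∧ LocalSign p ε o m k) hLA
  have hmF := mem_filter_forall_val_iff (localModulus p) (LocalFundamental p) hLF
  have hmA := mem_filter_forall_val_iff (localModulus p)
    (fun o m k => LocalFundamental p o m k ∧ LocalSign p ε o m k) hLA
  have hsome : ∀ i, ((p i : ℝ) ^ 2 - 1) ≠ 0 := by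
    intro i
    have : (1 : ℝ) < p i := by exact_mod_cast (hp i).one_lt
    nlinarith
  have hone : ∀ o, LocalFundamental p o 1 1 := by
    rintro (_ | i)
    · exact ⟨Or.inl rfl, Or.inl rfl⟩
    · have : ¬ p i ^ 2 ∣ 1 := fun h => (hp i).one_lt.ne'
        (Nat.dvd_one.1 ((dvd_pow_self _ two_ne_zero).trans h))
      exact ⟨this, this⟩
  have h := tendsto_ncard_pairs_div hM (R := Finset.univ.filter fun ab =>
      ∀ o, LocalFundamental p o ab.1.val ab.2.val ∧ LocalSign p ε o ab.1.val ab.2.val) (S := _)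
    ⟨_, (hmF 1 1).2 hone⟩
    (fun a b => (IsFundamentalDiscriminant a ∧ IsFundamentalDiscriminant b ∧ 1 < a ∧ 1 < b) ∧
      ∀ i, (jacobiSym b (p i) ≠ 0 → jacobiSym b (p i) = ε i) ∧
        (jacobiSym b (p i) = 0 → jacobiSym a (p i) = ε i))
    (fun a b => IsFundamentalDiscriminant a ∧ IsFundamentalDiscriminant b ∧ 1 < a ∧ 1 < b)
    (fun a b h => h.1.2.2) (fun a b h => h.2.2) (fun m k => ?_) (fun m k => ?_)
  rotate_left
  · rw [hmA, pair_isFundamentalDiscriminant_iff hp hodd]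
    have hs : (∀ o, LocalSign p ε o m k) ↔ ∀ i, (jacobiSym k (p i) ≠ 0 → jacobiSym k (p i) = ε i) ∧
        (jacobiSym k (p i) = 0 → jacobiSym m (p i) = ε i) := by
      simp only [Option.forall, LocalSign, SignEq, true_and]
    rw [← hs, forall_and]
    tauto
  · rw [hmF, pair_isFundamentalDiscriminant_iff hp hodd]
  have hlim : ((∏ i ∈ Finset.univ.filter (fun i => ε i = 0), 1 / ((p i : ℝ) + 1) ^ 2) *
      (∏ i ∈ Finset.univ.filter (fun i => ε i ≠ 0),
        (p i : ℝ) * ((p i : ℝ) + 2) / (2 * ((p i : ℝ) + 1) ^ 2))) =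
      ((Finset.univ.filter fun ab : ZMod (∏ o, localModulus p o) × ZMod (∏ o, localModulus p o) =>
        ∀ o, LocalFundamental p o ab.1.val ab.2.val ∧ LocalSign p ε o ab.1.val ab.2.val).card : ℝ) /
      ((Finset.univ.filter fun ab : ZMod (∏ o, localModulus p o) × ZMod (∏ o, localModulus p o) =>
        ∀ o, LocalFundamental p o ab.1.val ab.2.val).card : ℝ) := by
    rw [hcF, hcA, ← Finset.prod_ite, Nat.cast_prod, Nat.cast_prod, ← Finset.prod_div_distrib,
      Fintype.prod_option]
    have hnone : (((Finset.range (localModulus p none) ×ˢ Finset.range (localModulus p none)).filter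
        fun uv => LocalFundamental p none uv.1 uv.2 ∧ LocalSign p ε none uv.1 uv.2).card : ℝ) =
        ((Finset.range (localModulus p none) ×ˢ Finset.range (localModulus p none)).filter
          fun uv => LocalFundamental p none uv.1 uv.2).card := by
      congr 2
      exact Finset.filter_congr fun uv _ => and_iff_left trivial
    have hnone0 : (((Finset.range (localModulus p none) ×ˢ
        Finset.range (localModulus p none)).filter
          fun uv => LocalFundamental p none uv.1 uv.2).card : ℝ) ≠ 0 := by
      rw [Nat.cast_ne_zero, ← Nat.pos_iff_ne_zero, Finset.card_pos]
      exact ⟨(1, 1), Finset.mem_filter.2 ⟨by simp [localModulus], hone none⟩⟩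
    rw [hnone, div_self hnone0, one_mul]
    refine Finset.prod_congr rfl fun i _ => ?_
    have hF : (((Finset.range (localModulus p (some i)) ×ˢ
        Finset.range (localModulus p (some i))).filter
          fun uv => LocalFundamental p (some i) uv.1 uv.2).card : ℝ) =
        ((p i : ℝ) ^ 2 - 1) ^ 2 := by
      rw [← card_localFundamental_some (hp i)]
      exact congrArg (fun s : Finset (ℕ × ℕ) => (s.card : ℝ))
        (Finset.ext fun uv => Finset.mem_filter.trans (Iff.symm Finset.mem_filter))
    have hA := card_localSign_some (hp i) (hodd i) (hε i)
    symm
    rw [hF, div_eq_iff (pow_ne_zero 2 (hsome i)), ← hA]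
    exact congrArg (fun s : Finset (ℕ × ℕ) => (s.card : ℝ))
      (Finset.ext fun uv => Finset.mem_filter.trans (Iff.symm Finset.mem_filter))
  rw [hlim]
  refine h.congr fun x => ?_
  congr 4
  · ext DD
    tauto
  · ext DD
    tauto
end

section
/- Let χ₁, χ₂ be Dirichlet characters modulo N₁, N₂ with values in ℂ and let k ≥ 2 be an integer. If σ_{χ₁,χ₂}^{k-1}(n) is a rational number for every positive integer n, then the product character χ₁χ₂ is real-valued; that is, χ₁(n)·χ₂(n) ∈ {−1, 0, 1} for every positive integer n (so χ₁χ₂ is trivial or quadratic). -/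
/-- The signed divisor sum `σ_{χ₁,χ₂}^{k-1}(n) = ∑_{d ∣ n} χ₁(n/d) χ₂(d) d^{k-1}`. -/
noncomputable def sigmaC {N₁ N₂ : ℕ} (χ₁ : DirichletCharacter ℂ N₁)
    (χ₂ : DirichletCharacter ℂ N₂) (k : ℕ) (n : ℕ) : ℂ :=
  ∑ d ∈ n.divisors, χ₁ ((n / d : ℕ) : ZMod N₁) * χ₂ ((d : ℕ) : ZMod N₂) * (d : ℂ) ^ (k - 1)

lemma sigmaC_prime {N₁ N₂ : ℕ} (χ₁ : DirichletCharacter ℂ N₁) (χ₂ : DirichletCharacter ℂ N₂)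
    (k : ℕ) {p : ℕ} (hp : p.Prime) :
    sigmaC χ₁ χ₂ k p = χ₁ (p : ZMod N₁) + χ₂ (p : ZMod N₂) * (p : ℂ) ^ (k - 1) := by
  rw [sigmaC, hp.sum_divisors]
  simp [Nat.div_self hp.pos, add_comm]

lemma sigmaC_prime_sq {N₁ N₂ : ℕ} (χ₁ : DirichletCharacter ℂ N₁)
    (χ₂ : DirichletCharacter ℂ N₂) (k : ℕ) {p : ℕ} (hp : p.Prime) :
    sigmaC χ₁ χ₂ k (p ^ 2) = χ₁ (p : ZMod N₁) ^ 2 +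
      χ₁ (p : ZMod N₁) * χ₂ (p : ZMod N₂) * (p : ℂ) ^ (k - 1) +
      (χ₂ (p : ZMod N₂) * (p : ℂ) ^ (k - 1)) ^ 2 := by
  have h₁ : p ^ 2 / p = p := by rw [sq, Nat.mul_div_cancel _ hp.pos]
  have h₂ : p ^ 2 / p ^ 2 = 1 := Nat.div_self (pow_pos hp.pos 2)
  rw [sigmaC, Nat.sum_divisors_prime_pow hp]
  simp only [Finset.sum_range_succ, Finset.sum_range_zero, pow_zero, pow_one, Nat.div_one, h₁, h₂,
    Nat.cast_one, Nat.cast_pow, map_one, map_pow, one_pow]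
  ring

lemma DirichletCharacter.eq_zero_or_norm_eq_one {N : ℕ} (χ : DirichletCharacter ℂ N)
    (a : ZMod N) : χ a = 0 ∨ ‖χ a‖ = 1 := by
  by_cases ha : IsUnit a
  · exact Or.inr (χ.unit_norm_eq_one ha.unit)
  · exact Or.inl (χ.map_nonunit ha)

/-- The product of the character values at a prime is rational, since
`σ(p) ^ 2 - σ(p ^ 2) = χ₁(p) χ₂(p) p ^ (k - 1)`. -/
lemma exists_rat_eq_mul_of_prime {N₁ N₂ : ℕ} (χ₁ : DirichletCharacter ℂ N₁)
    (χ₂ : DirichletCharacter ℂ N₂) (k : ℕ)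
    (hrat : ∀ n : ℕ, 0 < n → ∃ q : ℚ, sigmaC χ₁ χ₂ k n = (q : ℂ)) {p : ℕ} (hp : p.Prime) :
    ∃ q : ℚ, χ₁ (p : ZMod N₁) * χ₂ (p : ZMod N₂) = (q : ℂ) := by
  obtain ⟨a, ha⟩ := hrat p hp.pos
  obtain ⟨b, hb⟩ := hrat (p ^ 2) (pow_pos hp.pos 2)
  rw [sigmaC_prime χ₁ χ₂ k hp] at ha
  rw [sigmaC_prime_sq χ₁ χ₂ k hp] at hb
  have hp0 : (p : ℂ) ^ (k - 1) ≠ 0 := pow_ne_zero _ (Nat.cast_ne_zero.mpr hp.ne_zero)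
  refine ⟨(a ^ 2 - b) / (p : ℚ) ^ (k - 1), ?_⟩
  push_cast
  rw [eq_div_iff hp0, ← ha, ← hb]
  ring

lemma Rat.eq_neg_one_or_zero_or_one_of_norm {q : ℚ} {z : ℂ} (hz : z = (q : ℂ))
    (h : z = 0 ∨ ‖z‖ = 1) : z = -1 ∨ z = 0 ∨ z = 1 := by
  rcases h with h | h
  · exact Or.inr (Or.inl h)
  · rw [hz, Complex.norm_ratCast] at h
    have hq : |q| = 1 := by exact_mod_cast h
    rcases eq_or_eq_neg_of_abs_eq hq with rfl | rfl
    · exact Or.inr (Or.inr (by simpa using hz))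
    · exact Or.inl (by simpa using hz)

/-- If all the Fourier coefficients `σ_{χ₁,χ₂}^{k-1}(n)` are rational, then the product
character `χ₁χ₂` is real-valued: `χ₁(n)χ₂(n) ∈ {-1, 0, 1}` for every `n ≥ 1`. -/
theorem stmt_15 (N₁ N₂ : ℕ) (χ₁ : DirichletCharacter ℂ N₁) (χ₂ : DirichletCharacter ℂ N₂)
    (k : ℕ) (hk : 2 ≤ k)
    (hrat : ∀ n : ℕ, 0 < n → ∃ q : ℚ, sigmaC χ₁ χ₂ k n = (q : ℂ)) :
    ∀ n : ℕ, 0 < n →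
      χ₁ (n : ZMod N₁) * χ₂ (n : ZMod N₂) = -1 ∨
      χ₁ (n : ZMod N₁) * χ₂ (n : ZMod N₂) = 0 ∨
      χ₁ (n : ZMod N₁) * χ₂ (n : ZMod N₂) = 1 := by
  intro n
  induction n using induction_on_primes with
  | zero => intro h; exact absurd h (lt_irrefl 0)
  | one => intro _; simp
  | prime_mul p m hp ih =>
    intro h
    obtain ⟨q, hq⟩ := exists_rat_eq_mul_of_prime χ₁ χ₂ k hrat hp
    have hpv := Rat.eq_neg_one_or_zero_or_one_of_norm hq (by
      rcases χ₁.eq_zero_or_norm_eq_one p with h₁ | h₁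
      · simp [h₁]
      rcases χ₂.eq_zero_or_norm_eq_one p with h₂ | h₂
      · simp [h₂]
      · simp [h₁, h₂])
    have hmul : χ₁ ((p * m : ℕ) : ZMod N₁) * χ₂ ((p * m : ℕ) : ZMod N₂) =
        (χ₁ (p : ZMod N₁) * χ₂ (p : ZMod N₂)) * (χ₁ (m : ZMod N₁) * χ₂ (m : ZMod N₂)) := by
      simp only [Nat.cast_mul, map_mul]
      ring
    rw [hmul]
    rcases hpv with e | e | e <;> rcases ih (Nat.pos_of_mul_pos_left h) with f | f | f <;>
      simp [e, f]
end
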